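/- arXiv:1108.0637 — 2 statements merged into one kernel-verified Lean document; each statement's English description precedes it below -/
import Mathlib

section
/- Let R > 0, q > 0, and let λ₁ = π²/R² be the first eigenvalue of −Δ on B_R with zero Dirichlet boundary conditions. If λ ∈ ((3/10)λ₁, λ₁), then problem (P) admits a classical solution (u, φ) with u > 0 and φ > 0 in B_R. -/
open Metric Real Set

noncomputable section

/-- Euclidean 3-space. -/
abbrev E3 := EuclideanSpace ℝ (Fin 3)

/-- The Laplace operator on functions `ℝ³ → ℝ`. -/
def lap (f : E3 → ℝ) (x : E3) : ℝ :=
  ∑ i : Fin 3, fderiv ℝ (fun y => fderiv ℝ f y (EuclideanSpace.single i 1)) x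
    (EuclideanSpace.single i 1)

/-- `(u, φ)` is a classical solution of problem (P) on the ball `B_R`:
`u, φ` are `C²` in `B_R`, continuous on the closed ball, satisfy
`-Δu = λu + q|u|³u·φ` and `-Δφ = q|u|⁵` pointwise in `B_R`, and vanish on `∂B_R`. -/
def IsSolP (R q lam : ℝ) (u φ : E3 → ℝ) : Prop :=
  ContDiffOn ℝ 2 u (ball 0 R) ∧ ContDiffOn ℝ 2 φ (ball 0 R) ∧
  ContinuousOn u (closedBall 0 R) ∧ ContinuousOn φ (closedBall 0 R) ∧
  (∀ x ∈ ball (0:E3) R, -lap u x = lam * u x + q * |u x| ^ 3 * u x * φ x) ∧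
  (∀ x ∈ ball (0:E3) R, -lap φ x = q * |u x| ^ 5) ∧
  (∀ x ∈ sphere (0:E3) R, u x = 0) ∧ (∀ x ∈ sphere (0:E3) R, φ x = 0)

section

open Filter Topology

/-! ### One-dimensional calculus on `[0, 1]` -/

/-- The Cauchy–Schwarz bound for the increment of a `C¹` function. -/
lemma sq_sub_le_mul_integral_sq {f f' : ℝ → ℝ} (hf : ∀ r, HasDerivAt f (f' r) r)
    (hc : Continuous f') {a b : ℝ} (hab : a ≤ b) :
    (f b - f a) ^ 2 ≤ (b - a) * ∫ r in a..b, f' r ^ 2 := by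
  have h_int : ∀ g : ℝ → ℝ, Continuous g → IntervalIntegrable g MeasureTheory.volume a b :=
    fun g hg => hg.intervalIntegrable _ _
  have h1 : ∫ r in a..b, f' r = f b - f a :=
    intervalIntegral.integral_eq_sub_of_hasDerivAt (fun r _ => hf r) (h_int _ hc)
  rcases hab.eq_or_lt with rfl | hlt
  · simp
  set m := f b - f a with hm
  have h2 : 0 ≤ ∫ r in a..b, (f' r * (b - a) - m) ^ 2 :=
    intervalIntegral.integral_nonneg hab fun r _ => sq_nonneg _
  have h3 : ∫ r in a..b, (f' r * (b - a) - m) ^ 2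
      = (b - a) ^ 2 * (∫ r in a..b, f' r ^ 2) - 2 * (b - a) * m * m + (b - a) * m ^ 2 := by
    have : ∀ r, (f' r * (b - a) - m) ^ 2
        = (b - a) ^ 2 * f' r ^ 2 - 2 * (b - a) * m * f' r + m ^ 2 := fun r => by ring
    simp_rw [this]
    rw [intervalIntegral.integral_add (h_int _ (by fun_prop)) (h_int _ (by fun_prop)),
      intervalIntegral.integral_sub (h_int _ (by fun_prop)) (h_int _ (by fun_prop)),
      intervalIntegral.integral_const_mul, intervalIntegral.integral_const_mul, h1]
    simp
  rw [h3] at h2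
  have h4 : 0 ≤ (b - a) * ((b - a) * (∫ r in a..b, f' r ^ 2) - m ^ 2) := by linarith
  have := nonneg_of_mul_nonneg_right h4 (sub_pos.2 hlt)
  linarith

/-- Integration by parts against a function vanishing at both end points. -/
lemma integral_deriv_mul_deriv {φ' φ'' η η' : ℝ → ℝ} (hφ : ∀ r, HasDerivAt φ' (φ'' r) r)
    (hη : ∀ r, HasDerivAt η (η' r) r) (hφc : Continuous φ'') (hηc : Continuous η')
    (h0 : η 0 = 0) (h1 : η 1 = 0) :
    ∫ r in (0 : ℝ)..1, φ' r * η' r = -∫ r in (0 : ℝ)..1, φ'' r * η r := by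
  have := intervalIntegral.integral_mul_deriv_eq_deriv_mul (a := 0) (b := 1)
    (fun r _ => hφ r) (fun r _ => hη r) (hφc.intervalIntegrable _ _) (hηc.intervalIntegrable _ _)
  rw [this, h0, h1]
  ring

/-- The Poincaré inequality on `[0, 1]`, with any constant below the optimal one. -/
lemma mul_integral_sq_le_integral_deriv_sq {f f' : ℝ → ℝ} (hf : ∀ r, HasDerivAt f (f' r) r)
    (hc : Continuous f') (h0 : f 0 = 0) (h1 : f 1 = 0) {σ : ℝ} (hσ : 0 < σ) (hσπ : σ < π) :
    σ ^ 2 * ∫ r in (0 : ℝ)..1, f r ^ 2 ≤ ∫ r in (0 : ℝ)..1, f' r ^ 2 := by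
  have hfc : Continuous f := continuous_iff_continuousAt.2 fun r => (hf r).continuousAt
  set δ := (π - σ) / 2 with hδ
  have hpos : ∀ r ∈ Icc (0 : ℝ) 1, 0 < sin (σ * r + δ) := by
    intro r hr
    have h3 : σ * r ≤ σ := by nlinarith [hr.1, hr.2]
    have h4 : 0 ≤ σ * r := mul_nonneg hσ.le hr.1
    exact sin_pos_of_pos_of_lt_pi (by linarith) (by linarith)
  set ψ : ℝ → ℝ := fun r => σ * cos (σ * r + δ) / sin (σ * r + δ) with hψ
  have hψc : ContinuousOn ψ (Icc 0 1) :=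
    ContinuousOn.div (by fun_prop) (by fun_prop) fun r hr => (hpos r hr).ne'
  have hψd : ∀ r ∈ Icc (0 : ℝ) 1, HasDerivAt ψ (-σ ^ 2 - ψ r ^ 2) r := by
    intro r hr
    have hs := (hpos r hr).ne'
    have hl : HasDerivAt (fun r : ℝ => σ * r + δ) σ r := by
      simpa using ((hasDerivAt_id r).const_mul σ).add_const δ
    have := ((hl.cos).const_mul σ).div hl.sin hs
    refine this.congr_deriv ?_
    simp only [hψ]
    field_simp
  have huI : uIcc (0 : ℝ) 1 = Icc 0 1 := uIcc_of_le zero_le_one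
  have h_int : ∀ g : ℝ → ℝ, ContinuousOn g (Icc 0 1) →
      IntervalIntegrable g MeasureTheory.volume 0 1 :=
    fun g hg => ContinuousOn.intervalIntegrable (huI ▸ hg)
  have hz : ∫ r in (0 : ℝ)..1, (2 * f r * f' r * ψ r + f r ^ 2 * (-σ ^ 2 - ψ r ^ 2)) = 0 := by
    have := intervalIntegral.integral_eq_sub_of_hasDerivAt (a := 0) (b := 1)
      (f := fun r => f r ^ 2 * ψ r)
      (f' := fun r => 2 * f r * f' r * ψ r + f r ^ 2 * (-σ ^ 2 - ψ r ^ 2)) (fun r hr => by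
        have := ((hf r).pow 2).mul (hψd r (huI ▸ hr))
        refine this.congr_deriv ?_
        simp) (h_int _ (by fun_prop))
    rw [this, h0, h1]
    ring
  have hn : 0 ≤ ∫ r in (0 : ℝ)..1, (f' r - f r * ψ r) ^ 2 :=
    intervalIntegral.integral_nonneg zero_le_one fun r _ => sq_nonneg _
  have he : ∀ r, (f' r - f r * ψ r) ^ 2 = f' r ^ 2 - σ ^ 2 * f r ^ 2
      - (2 * f r * f' r * ψ r + f r ^ 2 * (-σ ^ 2 - ψ r ^ 2)) := fun r => by ring
  simp_rw [he] at hn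
  rw [intervalIntegral.integral_sub (h_int _ (by fun_prop)) (h_int _ (by fun_prop)),
    intervalIntegral.integral_sub (h_int _ (by fun_prop)) (h_int _ (by fun_prop)), hz,
    intervalIntegral.integral_const_mul] at hn
  linarith

/-- A normalized pair of solutions of `y'' = -λ y`, vanishing at `0` and at `1` respectively. -/
structure GreenPair (lam : ℝ) where
  α : ℝ → ℝ
  β : ℝ → ℝ
  α' : ℝ → ℝ
  β' : ℝ → ℝ
  hα : ∀ r, HasDerivAt α (α' r) r
  hα' : ∀ r, HasDerivAt α' (-lam * α r) r
  hβ : ∀ r, HasDerivAt β (β' r) r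
  hβ' : ∀ r, HasDerivAt β' (-lam * β r) r
  α_zero : α 0 = 0
  β_one : β 1 = 0
  wronskian : ∀ r, α' r * β r - α r * β' r = 1
  α_nonneg : ∀ r ∈ Icc (0 : ℝ) 1, 0 ≤ α r
  β_nonneg : ∀ r ∈ Icc (0 : ℝ) 1, 0 ≤ β r

namespace GreenPair

variable {lam : ℝ} (G : GreenPair lam)

lemma continuous_α : Continuous G.α :=
  continuous_iff_continuousAt.2 fun r => (G.hα r).continuousAt
lemma continuous_β : Continuous G.β :=
  continuous_iff_continuousAt.2 fun r => (G.hβ r).continuousAt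
lemma continuous_α' : Continuous G.α' :=
  continuous_iff_continuousAt.2 fun r => (G.hα' r).continuousAt

/-- The solution of `-y'' = λ y + p` with `y(0) = y(1) = 0`. -/
def sol (p : ℝ → ℝ) (r : ℝ) : ℝ :=
  G.β r * (∫ s in (0 : ℝ)..r, G.α s * p s) + G.α r * ∫ s in r..1, G.β s * p s

/-- The derivative of `GreenPair.sol`. -/
def sol' (p : ℝ → ℝ) (r : ℝ) : ℝ :=
  G.β' r * (∫ s in (0 : ℝ)..r, G.α s * p s) + G.α' r * ∫ s in r..1, G.β s * p s

lemma hasDerivAt_integral_left {p : ℝ → ℝ} (hp : Continuous p) (r : ℝ) :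
    HasDerivAt (fun r => ∫ s in (0 : ℝ)..r, G.α s * p s) (G.α r * p r) r :=
  have hc : Continuous fun s => G.α s * p s := G.continuous_α.mul hp
  intervalIntegral.integral_hasDerivAt_right (hc.intervalIntegrable _ _)
    (hc.stronglyMeasurableAtFilter _ _) hc.continuousAt

lemma hasDerivAt_integral_right {p : ℝ → ℝ} (hp : Continuous p) (r : ℝ) :
    HasDerivAt (fun r => ∫ s in r..1, G.β s * p s) (-(G.β r * p r)) r :=
  have hc : Continuous fun s => G.β s * p s := G.continuous_β.mul hp
  intervalIntegral.integral_hasDerivAt_left (hc.intervalIntegrable _ _)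
    (hc.stronglyMeasurableAtFilter _ _) hc.continuousAt

lemma hasDerivAt_sol {p : ℝ → ℝ} (hp : Continuous p) (r : ℝ) :
    HasDerivAt (G.sol p) (G.sol' p r) r := by
  have := ((G.hβ r).mul (G.hasDerivAt_integral_left hp r)).add
    ((G.hα r).mul (G.hasDerivAt_integral_right hp r))
  refine this.congr_deriv ?_
  simp only [sol']
  ring

lemma hasDerivAt_sol' {p : ℝ → ℝ} (hp : Continuous p) (r : ℝ) :
    HasDerivAt (G.sol' p) (-lam * G.sol p r - p r) r := by
  have := ((G.hβ' r).mul (G.hasDerivAt_integral_left hp r)).add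
    ((G.hα' r).mul (G.hasDerivAt_integral_right hp r))
  refine this.congr_deriv ?_
  simp only [sol]
  linear_combination -p r * G.wronskian r

lemma continuous_sol {p : ℝ → ℝ} (hp : Continuous p) : Continuous (G.sol p) :=
  continuous_iff_continuousAt.2 fun r => (G.hasDerivAt_sol hp r).continuousAt
lemma continuous_sol' {p : ℝ → ℝ} (hp : Continuous p) : Continuous (G.sol' p) :=
  continuous_iff_continuousAt.2 fun r => (G.hasDerivAt_sol' hp r).continuousAt

@[simp] lemma sol_zero (p : ℝ → ℝ) : G.sol p 0 = 0 := by simp [sol, G.α_zero]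
@[simp] lemma sol_one (p : ℝ → ℝ) : G.sol p 1 = 0 := by simp [sol, G.β_one]

lemma sol_nonneg {p : ℝ → ℝ} (hp : ∀ r ∈ Icc (0 : ℝ) 1, 0 ≤ p r) :
    ∀ r ∈ Icc (0 : ℝ) 1, 0 ≤ G.sol p r := by
  intro r hr
  refine add_nonneg (mul_nonneg (G.β_nonneg r hr) ?_) (mul_nonneg (G.α_nonneg r hr) ?_)
  · refine intervalIntegral.integral_nonneg hr.1 fun s hs => ?_
    have hs' : s ∈ Icc (0 : ℝ) 1 := ⟨hs.1, hs.2.trans hr.2⟩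
    exact mul_nonneg (G.α_nonneg s hs') (hp s hs')
  · refine intervalIntegral.integral_nonneg hr.2 fun s hs => ?_
    have hs' : s ∈ Icc (0 : ℝ) 1 := ⟨hr.1.trans hs.1, hs.2⟩
    exact mul_nonneg (G.β_nonneg s hs') (hp s hs')

/-- The Green pair of `-y''`. -/
def laplace : GreenPair 0 where
  α := fun r => r
  β := fun r => 1 - r
  α' := fun _ => 1
  β' := fun _ => -1
  hα := fun r => hasDerivAt_id r
  hα' := fun r => by simpa using hasDerivAt_const r (1 : ℝ)
  hβ := fun r => by simpa using (hasDerivAt_id r).const_sub 1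
  hβ' := fun r => by simpa using hasDerivAt_const r (-1 : ℝ)
  α_zero := rfl
  β_one := sub_self 1
  wronskian := fun r => by ring
  α_nonneg := fun r hr => hr.1
  β_nonneg := fun r hr => sub_nonneg.2 hr.2

/-- The Green pair of `-y'' - s² y`. -/
def helmholtz (s : ℝ) (hs : 0 < s) (hsπ : s < π) : GreenPair (s ^ 2) where
  α := fun r => sin (s * r) / (s * sin s)
  β := fun r => sin (s * (1 - r))
  α' := fun r => cos (s * r) / sin s
  β' := fun r => -s * cos (s * (1 - r))
  hα := fun r => by
    have hl : HasDerivAt (fun r : ℝ => s * r) s r := by simpa using (hasDerivAt_id r).const_mul s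
    refine HasDerivAt.congr_deriv (hl.sin.div_const (s * sin s)) ?_
    have := (sin_pos_of_pos_of_lt_pi hs hsπ).ne'
    field_simp
  hα' := fun r => by
    have hl : HasDerivAt (fun r : ℝ => s * r) s r := by simpa using (hasDerivAt_id r).const_mul s
    refine HasDerivAt.congr_deriv (hl.cos.div_const (sin s)) ?_
    have := (sin_pos_of_pos_of_lt_pi hs hsπ).ne'
    field_simp
  hβ := fun r => by
    have hl : HasDerivAt (fun r : ℝ => s * (1 - r)) (-s) r := by
      simpa using ((hasDerivAt_id r).const_sub 1).const_mul s
    refine HasDerivAt.congr_deriv (hl.sin) ?_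
    ring
  hβ' := fun r => by
    have hl : HasDerivAt (fun r : ℝ => s * (1 - r)) (-s) r := by
      simpa using ((hasDerivAt_id r).const_sub 1).const_mul s
    refine HasDerivAt.congr_deriv (hl.cos.const_mul (-s)) ?_
    ring
  α_zero := by simp
  β_one := by simp
  wronskian := fun r => by
    have := (sin_pos_of_pos_of_lt_pi hs hsπ).ne'
    have h : sin s = sin (s * r) * cos (s * (1 - r)) + cos (s * r) * sin (s * (1 - r)) := by
      rw [← sin_add]; congr 1; ring
    field_simp
    linarith
  α_nonneg := fun r hr => by
    have h1 := (sin_pos_of_pos_of_lt_pi hs hsπ)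
    have h2 : 0 ≤ sin (s * r) :=
      sin_nonneg_of_nonneg_of_le_pi (mul_nonneg hs.le hr.1) (by nlinarith [hr.1, hr.2])
    positivity
  β_nonneg := fun r hr => sin_nonneg_of_nonneg_of_le_pi
    (mul_nonneg hs.le (sub_nonneg.2 hr.2)) (by nlinarith [hr.1, hr.2])

end GreenPair

/-- `u` is a radial profile: `r ↦ r u(r)` is `C¹` with derivative `f'`, `u ≥ 0` on `[0, 1]` and
`u(1) = 0`. -/
structure Adm (u f' : ℝ → ℝ) : Prop where
  cont : Continuous u
  cont' : Continuous f'
  deriv : ∀ r, HasDerivAt (fun r => r * u r) (f' r) r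
  one : u 1 = 0
  nonneg : ∀ r ∈ Icc (0 : ℝ) 1, 0 ≤ u r

/-- The calibration used in the proof of Bliss' inequality. -/
def calib (x e z : ℝ) : ℝ := z / 2 + e * (x / 2) * ∫ s in (0 : ℝ)..(z / x), √(1 - s ^ 2)

lemma hasDerivAt_calib {x : ℝ} (hx : 0 < x) (e z : ℝ) :
    HasDerivAt (calib x e) ((1 + e * √(1 - (z / x) ^ 2)) / 2) z := by
  have hc : Continuous fun s : ℝ => √(1 - s ^ 2) := by fun_prop
  have h1 : HasDerivAt (fun y => ∫ s in (0 : ℝ)..y, √(1 - s ^ 2)) (√(1 - (z / x) ^ 2)) (z / x) :=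
    intervalIntegral.integral_hasDerivAt_right (hc.intervalIntegrable _ _)
      (hc.stronglyMeasurableAtFilter _ _) hc.continuousAt
  have h2 := ((hasDerivAt_id z).div_const 2).add
    ((h1.comp z ((hasDerivAt_id z).div_const x)).const_mul (e * (x / 2)))
  refine h2.congr_deriv ?_
  field_simp

lemma integral_sqrt_one_sub_sq_half : ∫ s in (0 : ℝ)..1, √(1 - s ^ 2) = π / 4 := by
  have hc : Continuous fun s : ℝ => √(1 - s ^ 2) := by fun_prop
  have h := integral_sqrt_one_sub_sq
  rw [← intervalIntegral.integral_add_adjacent_intervals (b := 0) (hc.intervalIntegrable _ _)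
    (hc.intervalIntegrable _ _)] at h
  have h2 := intervalIntegral.integral_comp_neg (a := 0) (b := 1) fun s : ℝ => √(1 - s ^ 2)
  simp only [neg_sq, neg_zero] at h2
  rw [← h2] at h
  linarith

namespace Adm

variable {u f' : ℝ → ℝ} (h : Adm u f')
include h

lemma hasDerivAt_mul_sq {r : ℝ} (hr : 0 < r) :
    HasDerivAt (fun r => r * u r ^ 2) (2 * u r * f' r - u r ^ 2) r := by
  have h1 := ((h.deriv r).pow 2).div (hasDerivAt_id r) hr.ne'
  have h2 : (fun r => r * u r ^ 2) =ᶠ[nhds r] ((fun r => r * u r) ^ 2 / id) := by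
    filter_upwards [eventually_gt_nhds hr] with s hs
    simp only [Pi.div_apply, Pi.pow_apply, id]
    field_simp
  refine (h1.congr_of_eventuallyEq h2).congr_deriv ?_
  simp
  field_simp

lemma calib_le {x e : ℝ} (hx : 0 < x) (he : e ^ 2 = 1)
    (hle : ∀ r ∈ Icc (0 : ℝ) 1, r * u r ^ 2 ≤ x) {a b : ℝ} (ha : 0 ≤ a) (hab : a ≤ b)
    (hb : b ≤ 1) :
    calib x e (b * u b ^ 2) - calib x e (a * u a ^ 2)
      + 1 / (4 * x ^ 2) * (∫ r in a..b, r ^ 2 * u r ^ 6) ≤ ∫ r in a..b, f' r ^ 2 := by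
  have hu := h.cont
  have hf := h.cont'
  have hcal : Continuous (calib x e) :=
    continuous_iff_continuousAt.2 fun z => (hasDerivAt_calib hx e z).continuousAt
  set w : ℝ → ℝ := fun r => √(1 - (r * u r ^ 2 / x) ^ 2) with hw
  have hwc : Continuous w := by fun_prop
  have h_int : ∀ g : ℝ → ℝ, Continuous g → IntervalIntegrable g MeasureTheory.volume a b :=
    fun g hg => hg.intervalIntegrable _ _
  have h1 : ∫ r in a..b, (1 + e * w r) / 2 * (2 * u r * f' r - u r ^ 2)
      = calib x e (b * u b ^ 2) - calib x e (a * u a ^ 2) := by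
    refine intervalIntegral.integral_eq_sub_of_hasDerivAt_of_le hab
      (f := fun r => calib x e (r * u r ^ 2)) (by fun_prop) (fun r hr => ?_) (h_int _ (by fun_prop))
    exact (hasDerivAt_calib hx e _).comp r (h.hasDerivAt_mul_sq (ha.trans_lt hr.1))
  rw [← h1, ← intervalIntegral.integral_const_mul,
    ← intervalIntegral.integral_add (h_int _ (by fun_prop)) (h_int _ (by fun_prop))]
  refine intervalIntegral.integral_mono_on hab (h_int _ (by fun_prop)) (h_int _ (by fun_prop))
    fun r hr => ?_
  have hr' : r ∈ Icc (0 : ℝ) 1 := ⟨ha.trans hr.1, hr.2.trans hb⟩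
  have hz : (r * u r ^ 2 / x) ^ 2 ≤ 1 := by
    have h0 : 0 ≤ r * u r ^ 2 / x := by have := hr'.1; positivity
    have : r * u r ^ 2 / x ≤ 1 := (div_le_one hx).2 (hle r hr')
    exact pow_le_one₀ h0 this
  have hw2 : w r ^ 2 = 1 - (r * u r ^ 2 / x) ^ 2 := sq_sqrt (by linarith)
  have key : 1 / (4 * x ^ 2) * (r ^ 2 * u r ^ 6) = u r ^ 2 / 4 * (1 - w r ^ 2) := by
    rw [hw2]; field_simp; ring
  rw [key]
  have : (e * w r) ^ 2 = w r ^ 2 := by rw [mul_pow, he, one_mul]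
  nlinarith [sq_nonneg (f' r - u r / 2 * (1 + e * w r))]

/-- Bliss' inequality with the sharp constant. -/
theorem bliss : 27 * π ^ 2 / 256 * (∫ r in (0 : ℝ)..1, r ^ 2 * u r ^ 6)
    ≤ (∫ r in (0 : ℝ)..1, f' r ^ 2) ^ 3 := by
  have hu := h.cont
  have hf := h.cont'
  have hE : 0 ≤ ∫ r in (0 : ℝ)..1, f' r ^ 2 :=
    intervalIntegral.integral_nonneg zero_le_one fun r _ => sq_nonneg _
  obtain ⟨r₀, hr₀, hmax⟩ := isCompact_Icc.exists_isMaxOn (nonempty_Icc.2 (zero_le_one (α := ℝ)))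
    (f := fun r => r * u r ^ 2) (by fun_prop)
  set x := r₀ * u r₀ ^ 2 with hx
  have hle : ∀ r ∈ Icc (0 : ℝ) 1, r * u r ^ 2 ≤ x := fun r hr => hmax hr
  have hx0 : 0 ≤ x := by simpa using hle 0 (by simp)
  rcases hx0.eq_or_lt with hx0 | hxp
  · have : ∫ r in (0 : ℝ)..1, r ^ 2 * u r ^ 6 = 0 := by
      refine (intervalIntegral.integral_congr (g := fun _ => (0 : ℝ)) fun r hr => ?_).trans
        (by simp)
      rw [uIcc_of_le zero_le_one] at hr
      have h1 : r * u r ^ 2 = 0 :=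
        le_antisymm (hx0 ▸ hle r hr) (mul_nonneg hr.1 (sq_nonneg _))
      simp only
      calc r ^ 2 * u r ^ 6 = (r * u r ^ 2) ^ 2 * u r ^ 2 := by ring
        _ = 0 := by rw [h1]; ring
    rw [this]
    simpa using pow_nonneg hE 3
  · have e1 := h.calib_le hxp (e := 1) (by norm_num) hle le_rfl hr₀.1 hr₀.2
    have e2 := h.calib_le hxp (e := -1) (by norm_num) hle hr₀.1 hr₀.2 le_rfl
    have s1 := intervalIntegral.integral_add_adjacent_intervals (a := 0) (b := r₀) (c := 1)
      (μ := MeasureTheory.volume) (f := fun r => f' r ^ 2)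
      ((by fun_prop : Continuous fun r => f' r ^ 2).intervalIntegrable _ _)
      ((by fun_prop : Continuous fun r => f' r ^ 2).intervalIntegrable _ _)
    have s2 := intervalIntegral.integral_add_adjacent_intervals (a := 0) (b := r₀) (c := 1)
      (μ := MeasureTheory.volume) (f := fun r => r ^ 2 * u r ^ 6)
      ((by fun_prop : Continuous fun r => r ^ 2 * u r ^ 6).intervalIntegrable _ _)
      ((by fun_prop : Continuous fun r => r ^ 2 * u r ^ 6).intervalIntegrable _ _)
    have c1 : ∀ e, calib x e x = x / 2 + e * (x / 2) * (π / 4) := fun e => by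
      rw [calib, div_self hxp.ne', integral_sqrt_one_sub_sq_half]
    have c0 : ∀ e, calib x e 0 = 0 := fun e => by simp [calib]
    rw [← hx, c1, zero_mul, c0] at e1
    rw [← hx, c1, h.one] at e2
    rw [show (1 : ℝ) * 0 ^ 2 = 0 by norm_num, c0] at e2
    set E := ∫ r in (0 : ℝ)..1, f' r ^ 2
    set a := ∫ r in (0 : ℝ)..1, r ^ 2 * u r ^ 6
    have ha : 0 ≤ a := intervalIntegral.integral_nonneg zero_le_one fun r _ => by positivity
    have key : π * x / 4 + a / (4 * x ^ 2) ≤ E := by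
      have : a / (4 * x ^ 2) = 1 / (4 * x ^ 2) * (∫ r in (0 : ℝ)..r₀, r ^ 2 * u r ^ 6)
        + 1 / (4 * x ^ 2) * ∫ r in r₀..1, r ^ 2 * u r ^ 6 := by rw [← s2]; ring
      linarith
    have hp : 0 < π * x / 8 := by positivity
    set p := π * x / 8 with hpdef
    set t := a / (4 * x ^ 2) with ht
    have ht0 : 0 ≤ t := by positivity
    have haeq : 27 * π ^ 2 / 256 * a = 27 * p ^ 2 * t := by
      rw [hpdef, ht]; field_simp; ring
    have amgm : 27 * p ^ 2 * t ≤ (2 * p + t) ^ 3 := by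
      nlinarith [mul_nonneg (sq_nonneg (p - t)) (by linarith : 0 ≤ 8 * p + t)]
    rw [haeq]
    refine amgm.trans (pow_le_pow_left₀ (by positivity) ?_ 3)
    rw [hpdef]; linarith

end Adm

lemma GreenPair.mul_dslope_sol {lam : ℝ} (G : GreenPair lam) (p : ℝ → ℝ) (r : ℝ) :
    r * dslope (G.sol p) 0 r = G.sol p r := by
  simpa using sub_smul_dslope (G.sol p) 0 r

lemma continuous_dslope_zero {f f' : ℝ → ℝ} (hf : ∀ r, HasDerivAt f (f' r) r) :
    Continuous (dslope f 0) := by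
  refine continuous_iff_continuousAt.2 fun r => ?_
  rcases eq_or_ne r 0 with rfl | hr
  · exact continuousAt_dslope_same.2 (hf 0).differentiableAt
  · exact (continuousAt_dslope_of_ne hr).2 (hf r).continuousAt

lemma GreenPair.adm_dslope_sol {lam : ℝ} (G : GreenPair lam) {p : ℝ → ℝ} (hp : Continuous p)
    (hp0 : ∀ r ∈ Icc (0 : ℝ) 1, 0 ≤ p r) : Adm (dslope (G.sol p) 0) (G.sol' p) := by
  have hc := continuous_dslope_zero (G.hasDerivAt_sol hp)
  have hm := G.mul_dslope_sol p
  refine ⟨hc, G.continuous_sol' hp, fun r => ?_, by simpa using hm 1, ?_⟩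
  · rw [funext hm]; exact G.hasDerivAt_sol hp r
  · have hpos : ∀ r ∈ Ioo (0 : ℝ) 1, 0 ≤ dslope (G.sol p) 0 r := fun r hr => by
      refine nonneg_of_mul_nonneg_right (b := dslope (G.sol p) 0 r) (a := r) ?_ hr.1
      rw [hm]
      exact G.sol_nonneg hp0 r (Ioo_subset_Icc_self hr)
    have hcl : IsClosed {r | 0 ≤ dslope (G.sol p) 0 r} := isClosed_le continuous_const hc
    have := closure_minimal (s := Ioo (0 : ℝ) 1) hpos hcl
    rwa [closure_Ioo (by norm_num)] at this

/-- The source term `r u⁵` of the second equation. -/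
def srcF (u : ℝ → ℝ) (r : ℝ) : ℝ := r * u r ^ 5

/-- The potential generated by `u`, multiplied by `r`. -/
def pot (u : ℝ → ℝ) : ℝ → ℝ := GreenPair.laplace.sol (srcF u)

/-- The derivative of `pot u`. -/
def pot' (u : ℝ → ℝ) : ℝ → ℝ := GreenPair.laplace.sol' (srcF u)

/-- The nonlocal energy of `u`. -/
def dbl (u : ℝ → ℝ) : ℝ := ∫ r in (0 : ℝ)..1, pot u r * srcF u r

/-- The source term of the first equation. -/
def srcP (u : ℝ → ℝ) (r : ℝ) : ℝ := u r ^ 4 * pot u r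

lemma continuous_srcF {u : ℝ → ℝ} (hu : Continuous u) : Continuous (srcF u) := by
  unfold srcF; fun_prop

lemma continuous_pot {u : ℝ → ℝ} (hu : Continuous u) : Continuous (pot u) :=
  GreenPair.laplace.continuous_sol (continuous_srcF hu)

lemma continuous_pot' {u : ℝ → ℝ} (hu : Continuous u) : Continuous (pot' u) :=
  GreenPair.laplace.continuous_sol' (continuous_srcF hu)

lemma hasDerivAt_pot {u : ℝ → ℝ} (hu : Continuous u) (r : ℝ) :
    HasDerivAt (pot u) (pot' u r) r :=
  GreenPair.laplace.hasDerivAt_sol (continuous_srcF hu) r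

lemma hasDerivAt_pot' {u : ℝ → ℝ} (hu : Continuous u) (r : ℝ) :
    HasDerivAt (pot' u) (-srcF u r) r := by
  exact (GreenPair.laplace.hasDerivAt_sol' (continuous_srcF hu) r).congr_deriv (by simp)

lemma continuous_srcP {u : ℝ → ℝ} (hu : Continuous u) : Continuous (srcP u) :=
  (hu.pow 4).mul (continuous_pot hu)

@[simp] lemma pot_zero (u : ℝ → ℝ) : pot u 0 = 0 := GreenPair.sol_zero _ _
@[simp] lemma pot_one (u : ℝ → ℝ) : pot u 1 = 0 := GreenPair.sol_one _ _

lemma integral_pot'_mul {u η η' : ℝ → ℝ} (hu : Continuous u) (hη : ∀ r, HasDerivAt η (η' r) r)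
    (hηc : Continuous η') (h0 : η 0 = 0) (h1 : η 1 = 0) :
    ∫ r in (0 : ℝ)..1, pot' u r * η' r = ∫ r in (0 : ℝ)..1, η r * srcF u r := by
  rw [integral_deriv_mul_deriv (hasDerivAt_pot' hu) hη (continuous_srcF hu).neg hηc h0 h1,
    ← intervalIntegral.integral_neg]
  exact intervalIntegral.integral_congr fun r _ => by ring

lemma dbl_eq {u : ℝ → ℝ} (hu : Continuous u) : dbl u = ∫ r in (0 : ℝ)..1, pot' u r ^ 2 := by
  simp_rw [sq]
  exact (integral_pot'_mul hu (hasDerivAt_pot hu) (continuous_pot' hu) (by simp) (by simp)).symm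

lemma le_dbl {u η η' : ℝ → ℝ} (hu : Continuous u) (hη : ∀ r, HasDerivAt η (η' r) r)
    (hηc : Continuous η') (h0 : η 0 = 0) (h1 : η 1 = 0) :
    2 * (∫ r in (0 : ℝ)..1, η r * srcF u r) - ∫ r in (0 : ℝ)..1, η' r ^ 2 ≤ dbl u := by
  have hp := continuous_pot' hu
  have h_int : ∀ g : ℝ → ℝ, Continuous g → IntervalIntegrable g MeasureTheory.volume 0 1 :=
    fun g hg => hg.intervalIntegrable _ _
  have hn : 0 ≤ ∫ r in (0 : ℝ)..1, (η' r - pot' u r) ^ 2 :=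
    intervalIntegral.integral_nonneg zero_le_one fun r _ => sq_nonneg _
  have he : ∀ r, (η' r - pot' u r) ^ 2 = η' r ^ 2 - 2 * (pot' u r * η' r) + pot' u r ^ 2 :=
    fun r => by ring
  simp_rw [he] at hn
  rw [intervalIntegral.integral_add (h_int _ (by fun_prop)) (h_int _ (by fun_prop)),
    intervalIntegral.integral_sub (h_int _ (by fun_prop)) (h_int _ (by fun_prop)),
    intervalIntegral.integral_const_mul, integral_pot'_mul hu hη hηc h0 h1, ← dbl_eq hu] at hn
  linarith

namespace Adm

variable {u f' : ℝ → ℝ} (h : Adm u f')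
include h

lemma srcF_nonneg : ∀ r ∈ Icc (0 : ℝ) 1, 0 ≤ srcF u r := fun r hr =>
  mul_nonneg hr.1 (pow_nonneg (h.nonneg r hr) 5)

lemma pot_nonneg : ∀ r ∈ Icc (0 : ℝ) 1, 0 ≤ pot u r :=
  GreenPair.laplace.sol_nonneg h.srcF_nonneg

lemma srcP_nonneg : ∀ r ∈ Icc (0 : ℝ) 1, 0 ≤ srcP u r := fun r hr =>
  mul_nonneg (pow_nonneg (h.nonneg r hr) 4) (h.pot_nonneg r hr)

lemma adm_pot : Adm (dslope (pot u) 0) (pot' u) :=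
  GreenPair.laplace.adm_dslope_sol (continuous_srcF h.cont) h.srcF_nonneg

/-- The sharp bound of the nonlocal energy by the Dirichlet energy. -/
theorem dbl_le : dbl u ≤ (256 / (27 * π ^ 2)) ^ 2 * (∫ r in (0 : ℝ)..1, f' r ^ 2) ^ 5 := by
  set K := 256 / (27 * π ^ 2) with hK
  have hKp : 0 < K := by positivity
  set E := ∫ r in (0 : ℝ)..1, f' r ^ 2 with hE
  have hE0 : 0 ≤ E := intervalIntegral.integral_nonneg zero_le_one fun r _ => sq_nonneg _
  set D := dbl u with hD
  rcases le_or_gt D 0 with hD0 | hD0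
  · exact hD0.trans (by positivity)
  set v := dslope (pot u) 0 with hv
  have hvm : ∀ r, r * v r = pot u r := GreenPair.laplace.mul_dslope_sol _
  have hA := h.adm_pot
  have b1 : (∫ r in (0 : ℝ)..1, r ^ 2 * u r ^ 6) ≤ K * E ^ 3 := by
    have := h.bliss
    rw [hK, div_mul_eq_mul_div, le_div_iff₀ (by positivity)]
    linarith
  have b2 : (∫ r in (0 : ℝ)..1, r ^ 2 * v r ^ 6) ≤ K * D ^ 3 := by
    have := hA.bliss
    rw [← dbl_eq h.cont, ← hD] at this
    rw [hK, div_mul_eq_mul_div, le_div_iff₀ (by positivity)]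
    linarith
  have h_int : ∀ g : ℝ → ℝ, Continuous g → IntervalIntegrable g MeasureTheory.volume 0 1 :=
    fun g hg => hg.intervalIntegrable _ _
  have hvc := hA.cont
  have huc := h.cont
  have young : ∀ t : ℝ, 0 < t → 6 * D ≤ t ^ 30 * (K * D ^ 3) + 5 / t ^ 6 * (K * E ^ 3) := by
    intro t ht
    calc 6 * D = ∫ r in (0 : ℝ)..1, 6 * (pot u r * srcF u r) := by
          rw [intervalIntegral.integral_const_mul]; rfl
      _ ≤ ∫ r in (0 : ℝ)..1, (t ^ 30 * (r ^ 2 * v r ^ 6) + 5 / t ^ 6 * (r ^ 2 * u r ^ 6)) := by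
          refine intervalIntegral.integral_mono_on zero_le_one
            (h_int _ ((continuous_pot huc).mul (continuous_srcF huc) |>.const_mul 6))
            (h_int _ (by fun_prop)) fun r hr => ?_
          rw [← hvm, srcF]
          have key : ∀ x y : ℝ, 0 ≤ x → 0 ≤ y → 6 * (x * y ^ 5) ≤ x ^ 6 + 5 * y ^ 6 := by
            intro x y hx hy
            have : 0 ≤ (x - y) ^ 2 * (x ^ 4 + 2 * x ^ 3 * y + 3 * x ^ 2 * y ^ 2 + 4 * x * y ^ 3
              + 5 * y ^ 4) := by positivity
            nlinarith
          have hx : 0 ≤ t ^ 5 * v r := mul_nonneg (by positivity) (hA.nonneg r hr)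
          have hy : 0 ≤ u r / t := div_nonneg (h.nonneg r hr) ht.le
          have := mul_le_mul_of_nonneg_left (key _ _ hx hy) (sq_nonneg r)
          calc 6 * (r * v r * (r * u r ^ 5)) = r ^ 2 * (6 * (t ^ 5 * v r * (u r / t) ^ 5)) := by
                field_simp
            _ ≤ _ := this
            _ = _ := by field_simp
      _ = t ^ 30 * (∫ r in (0 : ℝ)..1, r ^ 2 * v r ^ 6)
          + 5 / t ^ 6 * ∫ r in (0 : ℝ)..1, r ^ 2 * u r ^ 6 := by
          rw [intervalIntegral.integral_add (h_int _ (by fun_prop)) (h_int _ (by fun_prop)),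
            intervalIntegral.integral_const_mul, intervalIntegral.integral_const_mul]
      _ ≤ _ := by gcongr
  have hEp : 0 < E := by
    rcases hE0.eq_or_lt with h0 | h0
    · exfalso
      have ht : 0 < 1 / (1 + K * D ^ 2) := by positivity
      have h1 := young _ ht
      rw [← h0] at h1
      have h2 : (1 / (1 + K * D ^ 2)) ^ 30 ≤ 1 / (1 + K * D ^ 2) :=
        pow_le_of_le_one ht.le (by rw [div_le_one (by positivity)]; nlinarith [mul_pos hKp (pow_pos hD0 2)]) (by norm_num)
      have h3 : 1 / (1 + K * D ^ 2) * (K * D ^ 3) ≤ D := by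
        rw [div_mul_eq_mul_div, div_le_iff₀ (by positivity)]
        nlinarith
      have h4 : (1 / (1 + K * D ^ 2)) ^ 30 * (K * D ^ 3) ≤ 1 / (1 + K * D ^ 2) * (K * D ^ 3) := by
        gcongr
      norm_num at h1
      norm_num at h4 h3
      linarith
    · exact h0
  set τ := K * E ^ 3 / D with hτ
  have hτp : 0 < τ := by positivity
  obtain ⟨t, ht, htτ⟩ : ∃ t : ℝ, 0 < t ∧ t ^ 6 = τ :=
    ⟨τ ^ (1 / 6 : ℝ), by positivity, by
      rw [← rpow_natCast, ← rpow_mul hτp.le]; norm_num⟩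
  have h1 := young t ht
  rw [show t ^ 30 = (t ^ 6) ^ 5 by ring, htτ] at h1
  have e1 : 5 / τ * (K * E ^ 3) = 5 * D := by rw [hτ]; field_simp
  have e2 : τ ^ 5 * (K * D ^ 3) = (K ^ 2 * E ^ 5) ^ 3 / D ^ 2 := by rw [hτ]; field_simp
  rw [e1, e2] at h1
  have h2 : D ≤ (K ^ 2 * E ^ 5) ^ 3 / D ^ 2 := by linarith
  rw [le_div_iff₀ (by positivity)] at h2
  have h3 : D ^ 3 ≤ (K ^ 2 * E ^ 5) ^ 3 := by linarith [show D * D ^ 2 = D ^ 3 by ring]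
  exact le_of_pow_le_pow_left₀ (by norm_num) (by positivity) h3

end Adm

/-- The quadratic form `∫ f'² - λ ∫ f²` controls the Dirichlet energy. -/
def Coercive (lam c : ℝ) : Prop :=
  ∀ η η' : ℝ → ℝ, (∀ r, HasDerivAt η (η' r) r) → Continuous η' → η 0 = 0 → η 1 = 0 →
    c * (∫ r in (0 : ℝ)..1, η' r ^ 2)
      ≤ (∫ r in (0 : ℝ)..1, η' r ^ 2) - lam * ∫ r in (0 : ℝ)..1, η r ^ 2

lemma exists_coercive {s : ℝ} (hs : 0 < s) (hsπ : s < π) : ∃ c, 0 < c ∧ Coercive (s ^ 2) c := by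
  obtain ⟨σ, h1, h2⟩ := exists_between hsπ
  have hσ : 0 < σ := hs.trans h1
  have hlt : s ^ 2 / σ ^ 2 < 1 := by
    rw [div_lt_one (by positivity)]
    exact pow_lt_pow_left₀ h1 hs.le (by norm_num)
  refine ⟨1 - s ^ 2 / σ ^ 2, by linarith, fun η η' hη hc h0 h1' => ?_⟩
  have := mul_integral_sq_le_integral_deriv_sq hη hc h0 h1' hσ h2
  have h3 : s ^ 2 * ∫ r in (0 : ℝ)..1, η r ^ 2
      ≤ s ^ 2 / σ ^ 2 * ∫ r in (0 : ℝ)..1, η' r ^ 2 := by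
    rw [div_mul_eq_mul_div, le_div_iff₀ (by positivity)]
    nlinarith [sq_nonneg s]
  linarith

/-- The quadratic form of `-d²/dr² - λ` evaluated at `r ↦ r u(r)`. -/
def quad (lam : ℝ) (u f' : ℝ → ℝ) : ℝ :=
  (∫ r in (0 : ℝ)..1, f' r ^ 2) - lam * ∫ r in (0 : ℝ)..1, (r * u r) ^ 2

lemma GreenPair.integral_sol'_mul {lam : ℝ} (G : GreenPair lam) {p η η' : ℝ → ℝ}
    (hp : Continuous p) (hη : ∀ r, HasDerivAt η (η' r) r)
    (hηc : Continuous η') (h0 : η 0 = 0) (h1 : η 1 = 0) :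
    ∫ r in (0 : ℝ)..1, G.sol' p r * η' r
      = lam * (∫ r in (0 : ℝ)..1, G.sol p r * η r) + ∫ r in (0 : ℝ)..1, p r * η r := by
  have hsc := G.continuous_sol hp
  have hηc' : Continuous η := continuous_iff_continuousAt.2 fun r => (hη r).continuousAt
  have h_int : ∀ g : ℝ → ℝ, Continuous g → IntervalIntegrable g MeasureTheory.volume 0 1 :=
    fun g hg => hg.intervalIntegrable _ _
  rw [integral_deriv_mul_deriv (G.hasDerivAt_sol' hp) hη (by fun_prop) hηc h0 h1,
    ← intervalIntegral.integral_const_mul, ← intervalIntegral.integral_neg,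
    ← intervalIntegral.integral_add (h_int _ (by fun_prop)) (h_int _ (by fun_prop))]
  exact intervalIntegral.integral_congr fun r _ => by ring

/-- One step of the ascent: solving the linearized problem and normalizing does not decrease the
nonlocal energy, and the gain controls the defect in the equation. -/
theorem Adm.step {lam c : ℝ} (G : GreenPair lam) (hlam : 0 ≤ lam) (hc : 0 < c)
    (hco : Coercive lam c) {u f' : ℝ → ℝ} (h : Adm u f') (hQ : quad lam u f' = 1)
    (hD : 0 < dbl u) :
    ∃ u₁ f₁' N, Adm u₁ f₁' ∧ quad lam u₁ f₁' = 1 ∧ dbl u ≤ N ∧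
      dbl u + 10 * (N - dbl u) ≤ dbl u₁ ∧
      (∀ r, G.sol (srcP u) r = N * (r * u₁ r)) ∧
      (∀ r ∈ Icc (0 : ℝ) 1,
        (G.sol (srcP u) r - dbl u * (r * u r)) ^ 2 ≤ (N ^ 2 - dbl u ^ 2) / c) ∧
      ConcaveOn ℝ (Icc 0 1) fun r => r * u₁ r := by
  have huc := h.cont
  have hfc := h.cont'
  set p := srcP u with hpdef
  have hp : Continuous p := continuous_srcP huc
  set φ := G.sol p with hφ
  set φ' := G.sol' p with hφ'
  have hφc : Continuous φ := G.continuous_sol hp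
  have hφc' : Continuous φ' := G.continuous_sol' hp
  have hφd : ∀ r, HasDerivAt φ (φ' r) r := G.hasDerivAt_sol hp
  set D := dbl u with hDdef
  have h_int : ∀ g : ℝ → ℝ, Continuous g → IntervalIntegrable g MeasureTheory.volume 0 1 :=
    fun g hg => hg.intervalIntegrable _ _
  set A := ∫ r in (0 : ℝ)..1, p r * φ r with hA
  have q1 : (∫ r in (0 : ℝ)..1, φ' r ^ 2) = lam * (∫ r in (0 : ℝ)..1, φ r ^ 2) + A := by
    simp_rw [sq]
    exact G.integral_sol'_mul hp hφd hφc' (by simp [hφ]) (by simp [hφ])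
  have q2 : (∫ r in (0 : ℝ)..1, φ' r * f' r)
      = lam * (∫ r in (0 : ℝ)..1, φ r * (r * u r)) + D := by
    have := G.integral_sol'_mul hp h.deriv hfc (by simp) (by simp [h.one])
    rw [this]
    congr 1
    exact intervalIntegral.integral_congr fun r _ => by simp only [hpdef, srcP, srcF]; ring
  set ψ' : ℝ → ℝ := fun r => φ' r - D * f' r with hψ'
  have hψd : ∀ r, HasDerivAt (fun r => φ r - D * (r * u r)) (ψ' r) r := fun r =>
    (hφd r).sub ((h.deriv r).const_mul D)
  have hψc : Continuous ψ' := by fun_prop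
  have hψ := hco _ ψ' hψd hψc (by simp [hφ]) (by simp [hφ, h.one])
  have e1 : ∫ r in (0 : ℝ)..1, ψ' r ^ 2 = (∫ r in (0 : ℝ)..1, φ' r ^ 2)
      - 2 * D * (∫ r in (0 : ℝ)..1, φ' r * f' r) + D ^ 2 * ∫ r in (0 : ℝ)..1, f' r ^ 2 := by
    have : ∀ r, ψ' r ^ 2 = φ' r ^ 2 - 2 * D * (φ' r * f' r) + D ^ 2 * f' r ^ 2 := fun r => by
      simp only [hψ']; ring
    simp_rw [this]
    rw [intervalIntegral.integral_add (h_int _ (by fun_prop)) (h_int _ (by fun_prop)),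
      intervalIntegral.integral_sub (h_int _ (by fun_prop)) (h_int _ (by fun_prop)),
      intervalIntegral.integral_const_mul, intervalIntegral.integral_const_mul]
  have e2 : ∫ r in (0 : ℝ)..1, (φ r - D * (r * u r)) ^ 2 = (∫ r in (0 : ℝ)..1, φ r ^ 2)
      - 2 * D * (∫ r in (0 : ℝ)..1, φ r * (r * u r))
      + D ^ 2 * ∫ r in (0 : ℝ)..1, (r * u r) ^ 2 := by
    have : ∀ r, (φ r - D * (r * u r)) ^ 2
        = φ r ^ 2 - 2 * D * (φ r * (r * u r)) + D ^ 2 * (r * u r) ^ 2 := fun r => by ring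
    simp_rw [this]
    rw [intervalIntegral.integral_add (h_int _ (by fun_prop)) (h_int _ (by fun_prop)),
      intervalIntegral.integral_sub (h_int _ (by fun_prop)) (h_int _ (by fun_prop)),
      intervalIntegral.integral_const_mul, intervalIntegral.integral_const_mul]
  have e3 : (∫ r in (0 : ℝ)..1, ψ' r ^ 2)
      - lam * ∫ r in (0 : ℝ)..1, (φ r - D * (r * u r)) ^ 2 = A - D ^ 2 := by
    rw [e1, e2, q1, q2]
    unfold quad at hQ
    linear_combination D ^ 2 * hQ
  rw [e3] at hψ
  have hE0 : 0 ≤ ∫ r in (0 : ℝ)..1, ψ' r ^ 2 :=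
    intervalIntegral.integral_nonneg zero_le_one fun r _ => sq_nonneg _
  have hAD : D ^ 2 ≤ A := by linarith [mul_nonneg hc.le hE0]
  have hA0 : 0 < A := (pow_pos hD 2).trans_le hAD
  set N := √A with hN
  have hN0 : 0 < N := sqrt_pos.2 hA0
  have hN2 : N ^ 2 = A := sq_sqrt hA0.le
  have hDN : D ≤ N := le_of_sq_le_sq (by rw [hN2]; exact hAD) hN0.le
  have hA' := G.adm_dslope_sol hp h.srcP_nonneg
  set v := dslope φ 0 with hv
  have hvm : ∀ r, r * v r = φ r := G.mul_dslope_sol p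
  have hvN : ∀ r, r * (v r / N) = φ r / N := fun r => by rw [← hvm]; ring
  have hA₁ : Adm (fun r => v r / N) fun r => φ' r / N := by
    refine ⟨hA'.cont.div_const _, hφc'.div_const _, fun r => ?_, by simp [hA'.one],
      fun r hr => div_nonneg (hA'.nonneg r hr) hN0.le⟩
    simp_rw [hvN]
    exact (hφd r).div_const N
  refine ⟨fun r => v r / N, fun r => φ' r / N, N, hA₁, ?_, hDN, ?_, fun r => ?_,
    fun r hr => ?_, ?_⟩
  · simp_rw [quad, hvN, div_pow]
    rw [intervalIntegral.integral_div, intervalIntegral.integral_div, q1, hN2]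
    field_simp
    ring
  · set u₁ : ℝ → ℝ := fun r => v r / N with hu₁
    have hu₁c : Continuous u₁ := hA₁.cont
    have hpc := continuous_pot huc
    have hF := continuous_srcF huc
    have hF₁ := continuous_srcF hu₁c
    have i1 : N = ∫ r in (0 : ℝ)..1, pot u r * (r * u r ^ 4 * u₁ r) := by
      have : ∀ r, pot u r * (r * u r ^ 4 * u₁ r) = p r * φ r / N := fun r => by
        rw [← hvm]; simp only [hpdef, srcP, hu₁]; ring
      simp_rw [this]
      rw [intervalIntegral.integral_div, ← hA, ← hN2]
      field_simp
    have i2 : (∫ r in (0 : ℝ)..1, pot u r * (r * u r ^ 4 * u₁ r))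
        ≤ ∫ r in (0 : ℝ)..1, (4 / 5 * (pot u r * srcF u r) + 1 / 5 * (pot u r * srcF u₁ r)) := by
      refine intervalIntegral.integral_mono_on zero_le_one (h_int _ (by fun_prop))
        (h_int _ (by fun_prop)) fun r hr => ?_
      have hx := h.nonneg r hr
      have hy := hA₁.nonneg r hr
      have key : 0 ≤ (u r - u₁ r) ^ 2 * (4 * u r ^ 3 + 3 * u r ^ 2 * u₁ r
        + 2 * u r * u₁ r ^ 2 + u₁ r ^ 3) := by positivity
      have h5 : u r ^ 4 * u₁ r ≤ 4 / 5 * u r ^ 5 + 1 / 5 * u₁ r ^ 5 := by nlinarith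
      have := mul_le_mul_of_nonneg_left h5 (mul_nonneg (h.pot_nonneg r hr) hr.1)
      simp only [srcF]
      linarith
    rw [intervalIntegral.integral_add (h_int _ (by fun_prop)) (h_int _ (by fun_prop)),
      intervalIntegral.integral_const_mul, intervalIntegral.integral_const_mul, ← i1] at i2
    have i3 := le_dbl hu₁c (hasDerivAt_pot huc) (continuous_pot' huc) (by simp) (by simp)
    rw [← dbl_eq huc] at i3
    have i4 : (∫ r in (0 : ℝ)..1, pot u r * srcF u r) = D := rfl
    rw [i4] at i2
    linarith
  · rw [hvN]; field_simp
  · have k1 := sq_sub_le_mul_integral_sq hψd hψc hr.1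
    have k2 : ∫ s in (0 : ℝ)..r, ψ' s ^ 2 ≤ ∫ s in (0 : ℝ)..1, ψ' s ^ 2 :=
      intervalIntegral.integral_mono_interval le_rfl hr.1 hr.2
        (Filter.Eventually.of_forall fun s => sq_nonneg _) (h_int _ (by fun_prop))
    have k3 : 0 ≤ ∫ s in (0 : ℝ)..r, ψ' s ^ 2 :=
      intervalIntegral.integral_nonneg hr.1 fun r _ => sq_nonneg _
    have k4 : φ 0 = 0 := by simp [hφ]
    rw [le_div_iff₀ hc, hN2]
    rw [k4] at k1
    simp only [zero_mul, mul_zero, sub_zero] at k1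
    have k5 : (φ r - D * (r * u r)) ^ 2 ≤ ∫ s in (0 : ℝ)..1, ψ' s ^ 2 :=
      (k1.trans (mul_le_of_le_one_left k3 hr.2)).trans k2
    linarith [mul_le_mul_of_nonneg_left k5 hc.le]
  · simp_rw [hvN]
    have hd1 : ∀ r, HasDerivAt (fun r => φ r / N) (φ' r / N) r := fun r => (hφd r).div_const N
    have hd2 : ∀ r, HasDerivAt (fun r => φ' r / N) ((-lam * φ r - p r) / N) r := fun r =>
      (G.hasDerivAt_sol' hp r).div_const N
    have hder : _root_.deriv (fun r => φ r / N) = fun r => φ' r / N := funext fun r => (hd1 r).deriv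
    refine concaveOn_of_deriv2_nonpos (convex_Icc 0 1) (hφc.div_const N).continuousOn
      (fun r _ => (hd1 r).differentiableAt.differentiableWithinAt)
      (by rw [hder]; exact fun r _ => (hd2 r).differentiableAt.differentiableWithinAt)
      fun r hr => ?_
    have hr' := interior_subset hr
    rw [Function.iterate_succ, Function.iterate_one, Function.comp_apply, hder, (hd2 r).deriv]
    have a1 := G.sol_nonneg h.srcP_nonneg r hr'
    have a2 := h.srcP_nonneg r hr'
    refine div_nonpos_of_nonpos_of_nonneg ?_ hN0.le
    have : 0 ≤ lam * φ r := mul_nonneg hlam a1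
    linarith

lemma Adm.energy_le {lam c : ℝ} (hc : 0 < c) (hco : Coercive lam c) {u f' : ℝ → ℝ}
    (h : Adm u f') (hQ : quad lam u f' = 1) : ∫ r in (0 : ℝ)..1, f' r ^ 2 ≤ 1 / c := by
  have := hco _ _ h.deriv h.cont' (by simp) (by simp [h.one])
  rw [le_div_iff₀ hc]
  unfold quad at hQ
  linarith

/-- A sequence of approximate solutions whose energy is bounded below by the initial energy. -/
theorem exists_palais_smale {lam c : ℝ} (G : GreenPair lam) (hlam : 0 ≤ lam) (hc : 0 < c)
    (hco : Coercive lam c) {u₀ f₀' : ℝ → ℝ} (h₀ : Adm u₀ f₀') (hQ₀ : quad lam u₀ f₀' = 1)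
    (hD₀ : 0 < dbl u₀) :
    ∃ (U V : ℕ → ℝ → ℝ) (M : ℝ), dbl u₀ ≤ M ∧ (∀ n, Adm (U n) (V n)) ∧
      (∀ n, quad lam (U n) (V n) = 1) ∧ (∀ n, ConcaveOn ℝ (Icc 0 1) fun r => r * U n r) ∧
      Tendsto (fun n => dbl (U n)) atTop (𝓝 M) ∧
      ∀ r ∈ Icc (0 : ℝ) 1,
        Tendsto (fun n => G.sol (srcP (U n)) r - dbl (U n) * (r * U n r)) atTop (𝓝 0) := by
  let S := {p : (ℝ → ℝ) × (ℝ → ℝ) // Adm p.1 p.2 ∧ quad lam p.1 p.2 = 1 ∧ dbl u₀ ≤ dbl p.1}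
  have hstep : ∀ p : S, ∃ (q : S) (N : ℝ), dbl p.1.1 ≤ N ∧
      dbl p.1.1 + 10 * (N - dbl p.1.1) ≤ dbl q.1.1 ∧
      (∀ r ∈ Icc (0 : ℝ) 1, (G.sol (srcP p.1.1) r - dbl p.1.1 * (r * p.1.1 r)) ^ 2
        ≤ (N ^ 2 - dbl p.1.1 ^ 2) / c) ∧
      ConcaveOn ℝ (Icc 0 1) fun r => r * q.1.1 r := by
    rintro ⟨⟨u, f'⟩, h, hQ, hD⟩
    obtain ⟨u₁, f₁', N, h1, h2, h3, h4, -, h6, h7⟩ := h.step G hlam hc hco hQ (hD₀.trans_le hD)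
    exact ⟨⟨⟨u₁, f₁'⟩, h1, h2, by simp only at hD ⊢; linarith⟩, N, h3, h4, h6, h7⟩
  choose next N hN1 hN2 hN3 hN4 using hstep
  let s : ℕ → S := fun n => next^[n] ⟨⟨u₀, f₀'⟩, h₀, hQ₀, le_rfl⟩
  have hs : ∀ n, s (n + 1) = next (s n) := fun n => Function.iterate_succ_apply' _ _ _
  set K : ℝ := (256 / (27 * π ^ 2)) ^ 2 * (1 / c) ^ 5 with hK
  have hbound : ∀ n, dbl (s n).1.1 ≤ K := fun n => by
    refine (s n).2.1.dbl_le.trans ?_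
    have h0 : 0 ≤ ∫ r in (0 : ℝ)..1, (s n).1.2 r ^ 2 :=
      intervalIntegral.integral_nonneg zero_le_one fun r _ => sq_nonneg _
    have := (s n).2.1.energy_le hc hco (s n).2.2.1
    exact mul_le_mul_of_nonneg_left (pow_le_pow_left₀ h0 this 5) (by positivity)
  have hmono : Monotone fun n => dbl (s n).1.1 := monotone_nat_of_le_succ fun n => by
    have h1 := hN1 (s n)
    have h2 := hN2 (s n)
    rw [hs]
    linarith
  have hlim := tendsto_atTop_ciSup hmono ⟨K, by rintro _ ⟨n, rfl⟩; exact hbound n⟩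
  set M := ⨆ n, dbl (s n).1.1 with hM
  have hlim1 := hlim.comp (tendsto_add_atTop_nat 1)
  have hdiff : Tendsto (fun n => dbl (s (n + 1)).1.1 - dbl (s n).1.1) atTop (𝓝 0) := by
    simpa using hlim1.sub hlim
  have hNlim : Tendsto (fun n => N (s n)) atTop (𝓝 M) := by
    have h1 : Tendsto (fun n => N (s n) - dbl (s n).1.1) atTop (𝓝 0) := by
      refine squeeze_zero (fun n => sub_nonneg.2 (hN1 _)) (fun n => ?_) hdiff
      have h1 := hN1 (s n)
      have h2 := hN2 (s n)
      rw [hs]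
      linarith
    simpa using h1.add hlim
  have hdef : ∀ r ∈ Icc (0 : ℝ) 1, Tendsto (fun n => G.sol (srcP (s n).1.1) r
      - dbl (s n).1.1 * (r * (s n).1.1 r)) atTop (𝓝 0) := by
    intro r hr
    have h1 : Tendsto (fun n => (N (s n) ^ 2 - dbl (s n).1.1 ^ 2) / c) atTop (𝓝 0) := by
      simpa using ((hNlim.pow 2).sub (hlim.pow 2)).div_const c
    have h2 := squeeze_zero (fun n => sq_nonneg _) (fun n => hN3 (s n) r hr) h1
    rw [tendsto_zero_iff_abs_tendsto_zero]
    have h3 := (continuous_sqrt.tendsto 0).comp h2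
    simpa [Function.comp_def, sqrt_sq_eq_abs] using h3
  refine ⟨fun n => (s (n + 1)).1.1, fun n => (s (n + 1)).1.2, M, ?_, fun n => (s _).2.1,
    fun n => (s _).2.2.1, fun n => ?_, hlim1, fun r hr => (hdef r hr).comp (tendsto_add_atTop_nat 1)⟩
  · exact ge_of_tendsto' hlim fun n => (s n).2.2.2
  · simp only [hs]; exact hN4 _

/-- Sequential compactness of families with a common Hölder modulus on `[0, 1]`. -/
lemma exists_subseq_tendsto_of_holder {f : ℕ → ℝ → ℝ} {C : ℝ} (h0 : ∀ n, f n 0 = 0)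
    (hf : ∀ n, ∀ a ∈ Icc (0 : ℝ) 1, ∀ b ∈ Icc (0 : ℝ) 1, |f n a - f n b| ≤ C * √|a - b|) :
    ∃ (g : ℝ → ℝ) (θ : ℕ → ℕ), StrictMono θ ∧
      ∀ r ∈ Icc (0 : ℝ) 1, Tendsto (fun n => f (θ n) r) atTop (𝓝 (g r)) := by
  have hmod : Tendsto (fun t : ℝ => C * √t) (𝓝 0) (𝓝 0) := by
    have : Continuous fun t : ℝ => C * √t := by fun_prop
    simpa using this.tendsto 0
  have heq : Equicontinuous fun n (x : Icc (0 : ℝ) 1) => f n x := by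
    refine Metric.equicontinuous_of_continuity_modulus (fun t => C * √t) hmod _ ?_
    intro x y n
    rw [Real.dist_eq]
    exact hf n x x.2 y y.2
  let F : ℕ → BoundedContinuousFunction (Icc (0 : ℝ) 1) ℝ := fun n =>
    BoundedContinuousFunction.mkOfCompact ⟨fun x => f n x, heq.continuous n⟩
  have hcomp : IsCompact (closure (range F)) := by
    refine BoundedContinuousFunction.arzela_ascoli _ (isCompact_closedBall (0 : ℝ) |C|) _ ?_ ?_
    · rintro _ x ⟨n, rfl⟩
      have h1 := hf n x x.2 0 (by simp)
      rw [h0] at h1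
      simp only [sub_zero] at h1
      rw [mem_closedBall_zero_iff, norm_eq_abs]
      refine h1.trans ?_
      have h2 : √|(x : ℝ)| ≤ 1 := by
        rw [abs_of_nonneg x.2.1, Real.sqrt_le_one]; exact x.2.2
      calc C * √|(x : ℝ)| ≤ |C| * √|(x : ℝ)| := by gcongr; exact le_abs_self C
        _ ≤ |C| := mul_le_of_le_one_right (abs_nonneg _) h2
    · refine Metric.equicontinuous_of_continuity_modulus (fun t => C * √t) hmod _ ?_
      rintro x y ⟨_, n, rfl⟩
      rw [Real.dist_eq]
      exact hf n x x.2 y y.2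
  obtain ⟨g, -, θ, hθ, hg⟩ := hcomp.tendsto_subseq fun n => subset_closure (mem_range_self n)
  refine ⟨fun r => if h : r ∈ Icc (0 : ℝ) 1 then g ⟨r, h⟩ else 0, θ, hθ, fun r hr => ?_⟩
  simp only [dif_pos hr]
  have := ((BoundedContinuousFunction.lipschitz_eval_const
    (⟨r, hr⟩ : Icc (0 : ℝ) 1)).continuous.tendsto g).comp hg
  exact this

lemma GreenPair.exists_bound {lam : ℝ} (G : GreenPair lam) :
    ∃ A, 0 < A ∧ (∀ s ∈ Icc (0 : ℝ) 1, G.α s ≤ A * s) ∧ ∀ s ∈ Icc (0 : ℝ) 1, G.β s ≤ A := by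
  obtain ⟨A, hA⟩ := isCompact_Icc.exists_bound_of_continuousOn (s := Icc (0 : ℝ) 1)
    G.continuous_α'.continuousOn
  obtain ⟨B, hB⟩ := isCompact_Icc.exists_bound_of_continuousOn (s := Icc (0 : ℝ) 1)
    G.continuous_β.continuousOn
  refine ⟨max (max A B) 1, by positivity, fun s hs => ?_, fun s hs => ?_⟩
  · have := (convex_Icc (0 : ℝ) 1).norm_image_sub_le_of_norm_hasDerivWithin_le
      (fun x _ => (G.hα x).hasDerivWithinAt) hA (left_mem_Icc.2 zero_le_one) hs
    rw [G.α_zero, sub_zero, sub_zero, norm_eq_abs, norm_eq_abs, abs_of_nonneg hs.1] at this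
    refine (le_abs_self _).trans (this.trans ?_)
    gcongr
    exacts [hs.1, (le_max_left _ _).trans (le_max_left _ _)]
  · exact ((le_abs_self _).trans (hB s hs)).trans ((le_max_right _ _).trans (le_max_left _ _))

lemma GreenPair.tendsto_sol {lam : ℝ} (G : GreenPair lam) {p : ℕ → ℝ → ℝ} {q : ℝ → ℝ} {C : ℝ}
    (hp : ∀ n, Continuous (p n))
    (hC : ∀ n, ∀ s ∈ Ioc (0 : ℝ) 1, |p n s| ≤ C * s ^ (-(3 / 2) : ℝ))
    (hlim : ∀ s ∈ Ioc (0 : ℝ) 1, Tendsto (fun n => p n s) atTop (𝓝 (q s))) :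
    ∀ r ∈ Icc (0 : ℝ) 1, Tendsto (fun n => G.sol (p n) r) atTop (𝓝 (G.sol q r)) := by
  intro r hr
  rcases hr.1.eq_or_lt with rfl | h0
  · simp
  obtain ⟨A, hA, hα, hβ⟩ := G.exists_bound
  refine Tendsto.add (Tendsto.const_mul _ ?_) (Tendsto.const_mul _ ?_)
  · refine intervalIntegral.tendsto_integral_filter_of_dominated_convergence
      (fun s => A * C * s ^ (-(1 / 2) : ℝ)) ?_ ?_ ?_ ?_
    · exact Eventually.of_forall fun n => (G.continuous_α.mul (hp n)).aestronglyMeasurable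
    · refine Eventually.of_forall fun n => Eventually.of_forall fun s hs => ?_
      rw [uIoc_of_le hr.1] at hs
      have hs' : s ∈ Ioc (0 : ℝ) 1 := ⟨hs.1, hs.2.trans hr.2⟩
      have hsI := Ioc_subset_Icc_self hs'
      rw [norm_mul, norm_eq_abs, norm_eq_abs, abs_of_nonneg (G.α_nonneg s hsI)]
      calc G.α s * |p n s| ≤ (A * s) * (C * s ^ (-(3 / 2) : ℝ)) :=
            mul_le_mul (hα s hsI) (hC n s hs') (abs_nonneg _) (mul_nonneg hA.le hs.1.le)
        _ = A * C * (s ^ (1 : ℝ) * s ^ (-(3 / 2) : ℝ)) := by rw [rpow_one]; ring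
        _ = _ := by rw [← rpow_add hs.1]; norm_num
    · exact (intervalIntegral.intervalIntegrable_rpow' (by norm_num)).const_mul _
    · refine Eventually.of_forall fun s hs => ?_
      rw [uIoc_of_le hr.1] at hs
      exact (hlim s ⟨hs.1, hs.2.trans hr.2⟩).const_mul _
  · refine intervalIntegral.tendsto_integral_filter_of_dominated_convergence
      (fun s => A * C * s ^ (-(3 / 2) : ℝ)) ?_ ?_ ?_ ?_
    · exact Eventually.of_forall fun n => (G.continuous_β.mul (hp n)).aestronglyMeasurable
    · refine Eventually.of_forall fun n => Eventually.of_forall fun s hs => ?_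
      rw [uIoc_of_le hr.2] at hs
      have hs' : s ∈ Ioc (0 : ℝ) 1 := ⟨h0.trans hs.1, hs.2⟩
      have hsI := Ioc_subset_Icc_self hs'
      rw [norm_mul, norm_eq_abs, norm_eq_abs, abs_of_nonneg (G.β_nonneg s hsI), mul_assoc]
      exact mul_le_mul (hβ s hsI) (hC n s hs') (abs_nonneg _) hA.le
    · refine (intervalIntegral.intervalIntegrable_rpow (Or.inr ?_)).const_mul _
      rw [uIcc_of_le hr.2]
      exact fun h => h0.not_ge h.1
    · refine Eventually.of_forall fun s hs => ?_
      rw [uIoc_of_le hr.2] at hs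
      exact (hlim s ⟨h0.trans hs.1, hs.2⟩).const_mul _

lemma Adm.abs_sub_le {u f' : ℝ → ℝ} (h : Adm u f') {E : ℝ}
    (hE : ∫ r in (0 : ℝ)..1, f' r ^ 2 ≤ E) :
    ∀ a ∈ Icc (0 : ℝ) 1, ∀ b ∈ Icc (0 : ℝ) 1, |a * u a - b * u b| ≤ √E * √|a - b| := by
  have key : ∀ a ∈ Icc (0 : ℝ) 1, ∀ b ∈ Icc (0 : ℝ) 1, a ≤ b →
      |a * u a - b * u b| ≤ √E * √|a - b| := by
    intro a ha b hb hab
    have h1 := sq_sub_le_mul_integral_sq h.deriv h.cont' hab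
    have h2 : ∫ r in a..b, f' r ^ 2 ≤ ∫ r in (0 : ℝ)..1, f' r ^ 2 :=
      intervalIntegral.integral_mono_interval ha.1 hab hb.2
        (Eventually.of_forall fun r => sq_nonneg _)
        ((h.cont'.pow 2).intervalIntegrable _ _)
    have h0 : 0 ≤ E := (intervalIntegral.integral_nonneg zero_le_one fun r _ => sq_nonneg _).trans hE
    rw [← sqrt_mul h0, abs_sub_comm a b, abs_of_nonneg (sub_nonneg.2 hab)]
    refine abs_le_sqrt ?_
    calc (a * u a - b * u b) ^ 2 = (b * u b - a * u a) ^ 2 := by ring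
      _ ≤ (b - a) * ∫ r in a..b, f' r ^ 2 := h1
      _ ≤ (b - a) * E := mul_le_mul_of_nonneg_left (h2.trans hE) (sub_nonneg.2 hab)
      _ = _ := mul_comm _ _
  intro a ha b hb
  rcases le_total a b with hab | hab
  · exact key a ha b hb hab
  · rw [abs_sub_comm, abs_sub_comm a b]; exact key b hb a ha hab

/-- A positive concave weak limit of approximate solutions. -/
theorem exists_limit_profile {lam c : ℝ} (G : GreenPair lam) (hlam : 0 ≤ lam) (hc : 0 < c)
    (hco : Coercive lam c) {u₀ f₀' : ℝ → ℝ} (h₀ : Adm u₀ f₀') (hQ₀ : quad lam u₀ f₀' = 1)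
    (hD₀ : (256 / (27 * π ^ 2)) ^ 2 < dbl u₀) :
    ∃ (f : ℝ → ℝ) (M C : ℝ), 0 < M ∧
      (∀ r ∈ Icc (0 : ℝ) 1, M * f r = G.sol (srcP fun s => f s / s) r) ∧
      ConcaveOn ℝ (Icc 0 1) f ∧ (∀ r ∈ Icc (0 : ℝ) 1, 0 ≤ f r) ∧ (∃ r ∈ Icc (0 : ℝ) 1, 0 < f r) ∧
      (∀ a ∈ Icc (0 : ℝ) 1, ∀ b ∈ Icc (0 : ℝ) 1, |f a - f b| ≤ C * √|a - b|) ∧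
      (∀ r ∈ Icc (0 : ℝ) 1, 0 ≤ pot (fun s => f s / s) r) ∧
      (∀ a ∈ Icc (0 : ℝ) 1, ∀ b ∈ Icc (0 : ℝ) 1,
        |pot (fun s => f s / s) a - pot (fun s => f s / s) b| ≤ C * √|a - b|) ∧
      ∀ δ ∈ Ioc (0 : ℝ) 1, ∫ r in δ..1, f r ^ 6 / r ^ 4 ≤ C := by
  set K := 256 / (27 * π ^ 2) with hK
  have hKp : 0 < K := by positivity
  have hD0 : 0 < dbl u₀ := (pow_pos hKp 2).trans hD₀
  obtain ⟨U, V, M, hM, hA, hQ, hconc, hD, hS⟩ := exists_palais_smale G hlam hc hco h₀ hQ₀ hD0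
  have hMp : 0 < M := hD0.trans_le hM
  set E := 1 / c with hE
  have hEp : 0 < E := by positivity
  have hEn : ∀ n, ∫ r in (0 : ℝ)..1, V n r ^ 2 ≤ E := fun n => (hA n).energy_le hc hco (hQ n)
  have hE0 : ∀ n, 0 ≤ ∫ r in (0 : ℝ)..1, V n r ^ 2 := fun n =>
    intervalIntegral.integral_nonneg zero_le_one fun r _ => sq_nonneg _
  set D := K ^ 2 * E ^ 5 with hDdef
  have hDn : ∀ n, dbl (U n) ≤ D := fun n =>
    (hA n).dbl_le.trans (mul_le_mul_of_nonneg_left (pow_le_pow_left₀ (hE0 n) (hEn n) 5) (by positivity))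
  obtain ⟨g, θ, hθ, hg⟩ := exists_subseq_tendsto_of_holder (f := fun n r => r * U n r)
    (fun n => by simp) (fun n => (hA n).abs_sub_le (hEn n))
  have hθ' := hθ.tendsto_atTop
  set u : ℝ → ℝ := fun s => g s / s with hu
  have hUu : ∀ s ∈ Ioc (0 : ℝ) 1, Tendsto (fun n => U (θ n) s) atTop (𝓝 (u s)) := fun s hs => by
    refine ((hg s (Ioc_subset_Icc_self hs)).div_const s).congr fun n => ?_
    rw [mul_div_cancel_left₀ _ hs.1.ne']
  have hUb : ∀ n, ∀ s ∈ Ioc (0 : ℝ) 1, |U n s| ≤ √E * s ^ (-(1 / 2) : ℝ) := fun n s hs => by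
    have h1 := (hA n).abs_sub_le (hEn n) s (Ioc_subset_Icc_self hs) 0 (by simp)
    rw [zero_mul, sub_zero, sub_zero, abs_mul, abs_of_pos hs.1] at h1
    refine le_of_mul_le_mul_left (h1.trans_eq ?_) hs.1
    rw [sqrt_eq_rpow s, mul_left_comm]
    congr 1
    nth_rw 2 [← rpow_one s]
    rw [← rpow_add hs.1]
    norm_num
  have hpotH : ∀ n, ∀ a ∈ Icc (0 : ℝ) 1, ∀ b ∈ Icc (0 : ℝ) 1,
      |pot (U n) a - pot (U n) b| ≤ √D * √|a - b| := fun n a ha b hb => by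
    have h1 := (hA n).adm_pot.abs_sub_le ((dbl_eq (hA n).cont).symm.trans_le (hDn n)) a ha b hb
    have h2 : ∀ s, s * dslope (pot (U n)) 0 s = pot (U n) s := GreenPair.laplace.mul_dslope_sol _
    rwa [h2, h2] at h1
  have hpotb : ∀ n, ∀ s ∈ Icc (0 : ℝ) 1, |pot (U n) s| ≤ √D * s ^ (1 / 2 : ℝ) := fun n s hs => by
    simpa [abs_of_nonneg hs.1, sqrt_eq_rpow s] using hpotH n s hs 0 (by simp)
  have hpot : ∀ r ∈ Icc (0 : ℝ) 1, Tendsto (fun n => pot (U (θ n)) r) atTop (𝓝 (pot u r)) := by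
    refine GreenPair.laplace.tendsto_sol (C := √E ^ 5) (fun n => continuous_srcF (hA _).cont) ?_ ?_
    · intro n s hs
      rw [srcF, abs_mul, abs_pow, abs_of_pos hs.1]
      calc s * |U (θ n) s| ^ 5 ≤ s * (√E * s ^ (-(1 / 2) : ℝ)) ^ 5 := by
            gcongr
            exacts [hs.1.le, hUb _ s hs]
        _ = √E ^ 5 * (s ^ (1 : ℝ) * s ^ (-(5 / 2) : ℝ)) := by
            rw [mul_pow, ← rpow_natCast (s ^ _), ← rpow_mul hs.1.le, rpow_one]
            norm_num; ring
        _ = _ := by rw [← rpow_add hs.1]; norm_num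
    · exact fun s hs => ((hUu s hs).pow 5).const_mul s
  have hsol : ∀ r ∈ Icc (0 : ℝ) 1,
      Tendsto (fun n => G.sol (srcP (U (θ n))) r) atTop (𝓝 (G.sol (srcP u) r)) := by
    refine G.tendsto_sol (C := √E ^ 4 * √D) (fun n => continuous_srcP (hA _).cont) ?_ ?_
    · intro n s hs
      rw [srcP, abs_mul, abs_pow]
      calc |U (θ n) s| ^ 4 * |pot (U (θ n)) s|
          ≤ (√E * s ^ (-(1 / 2) : ℝ)) ^ 4 * (√D * s ^ (1 / 2 : ℝ)) := by
            gcongr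
            exacts [hUb _ s hs, hpotb _ s (Ioc_subset_Icc_self hs)]
        _ = √E ^ 4 * √D * (s ^ (-2 : ℝ) * s ^ (1 / 2 : ℝ)) := by
            rw [mul_pow, ← rpow_natCast (s ^ _), ← rpow_mul hs.1.le]
            norm_num; ring
        _ = _ := by rw [← rpow_add hs.1]; norm_num
    · exact fun s hs => ((hUu s hs).pow 4).mul (hpot s (Ioc_subset_Icc_self hs))
  have hgn : ∀ r ∈ Icc (0 : ℝ) 1, 0 ≤ g r := fun r hr =>
    ge_of_tendsto' (hg r hr) fun n => mul_nonneg hr.1 ((hA _).nonneg r hr)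
  have hholder : ∀ a ∈ Icc (0 : ℝ) 1, ∀ b ∈ Icc (0 : ℝ) 1, |g a - g b| ≤ √E * √|a - b| :=
    fun a ha b hb => le_of_tendsto' ((hg a ha).sub (hg b hb)).abs
      fun n => (hA (θ n)).abs_sub_le (hEn _) a ha b hb
  refine ⟨g, M, max (max √E √D) (K * E ^ 3), hMp, fun r hr => ?_, ⟨convex_Icc 0 1, ?_⟩, hgn, ?_, ?_,
    fun r hr => ?_, ?_, ?_⟩
  · have h1 := ((hS r hr).comp hθ').add ((hD.comp hθ').mul (hg r hr))
    refine tendsto_nhds_unique (f := fun n => G.sol (srcP (U (θ n))) r) (l := atTop) ?_ (hsol r hr)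
    simpa [Function.comp_def] using h1
  · intro x hx y hy a b ha hb hab
    have hz := (convex_Icc (0 : ℝ) 1) hx hy ha hb hab
    exact le_of_tendsto_of_tendsto' (((hg x hx).const_mul a).add ((hg y hy).const_mul b)) (hg _ hz)
      fun n => (hconc (θ n)).2 hx hy ha hb hab
  · by_contra! hcon
    have hg0 : ∀ r ∈ Icc (0 : ℝ) 1, g r = 0 := fun r hr => le_antisymm (hcon r hr) (hgn r hr)
    have h1 : Tendsto (fun n => ∫ r in (0 : ℝ)..1, (r * U (θ n) r) ^ 2) atTop (𝓝 0) := by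
      have := intervalIntegral.tendsto_integral_filter_of_dominated_convergence
        (μ := MeasureTheory.volume) (a := 0) (b := 1) (l := atTop)
        (F := fun n r => (r * U (θ n) r) ^ 2) (f := fun _ => (0 : ℝ)) (fun _ => E) ?_ ?_ (by simp) ?_
      · simpa using this
      · refine Eventually.of_forall fun n => Continuous.aestronglyMeasurable ?_
        have := (hA (θ n)).cont
        fun_prop
      · refine Eventually.of_forall fun n => Eventually.of_forall fun s hs => ?_
        rw [uIoc_of_le zero_le_one] at hs
        have h1 := (hA (θ n)).abs_sub_le (hEn _) s (Ioc_subset_Icc_self hs) 0 (by simp)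
        rw [zero_mul, sub_zero, sub_zero, abs_of_pos hs.1] at h1
        rw [norm_pow, norm_eq_abs]
        calc |s * U (θ n) s| ^ 2 ≤ (√E * √s) ^ 2 := by gcongr
          _ = E * s := by rw [mul_pow, sq_sqrt hEp.le, sq_sqrt hs.1.le]
          _ ≤ E := mul_le_of_le_one_right hEp.le hs.2
      · refine Eventually.of_forall fun s hs => ?_
        rw [uIoc_of_le zero_le_one] at hs
        have := (hg s (Ioc_subset_Icc_self hs)).pow 2
        rwa [hg0 s (Ioc_subset_Icc_self hs), zero_pow two_ne_zero] at this
    have h2 : Tendsto (fun n => K ^ 2 * (1 + lam * ∫ r in (0 : ℝ)..1, (r * U (θ n) r) ^ 2) ^ 5) atTop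
        (𝓝 (K ^ 2 * (1 + lam * 0) ^ 5)) := (((h1.const_mul lam).const_add 1).pow 5).const_mul _
    have h3 := le_of_tendsto_of_tendsto' (hD.comp hθ') h2 fun n => by
      refine (hA (θ n)).dbl_le.trans_eq ?_
      have := hQ (θ n)
      unfold quad at this
      rw [show (∫ r in (0 : ℝ)..1, V (θ n) r ^ 2)
        = 1 + lam * ∫ r in (0 : ℝ)..1, (r * U (θ n) r) ^ 2 by linarith]
    simp only [mul_zero, add_zero, one_pow, mul_one] at h3
    linarith
  · intro a ha b hb
    refine (hholder a ha b hb).trans ?_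
    gcongr
    exact (le_max_left _ _).trans (le_max_left _ _)
  · exact ge_of_tendsto' (hpot r hr) fun n => (hA _).pot_nonneg r hr
  · intro a ha b hb
    refine (le_of_tendsto' ((hpot a ha).sub (hpot b hb)).abs
      fun n => hpotH (θ n) a ha b hb).trans ?_
    gcongr
    exact (le_max_right _ _).trans (le_max_left _ _)
  · intro δ hδ
    have h1 : Tendsto (fun n => ∫ r in δ..1, r ^ 2 * U (θ n) r ^ 6) atTop
        (𝓝 (∫ r in δ..1, g r ^ 6 / r ^ 4)) := by
      refine intervalIntegral.tendsto_integral_filter_of_dominated_convergence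
        (fun s => s ^ 2 * (√E * s ^ (-(1 / 2) : ℝ)) ^ 6) ?_ ?_ ?_ ?_
      · refine Eventually.of_forall fun n => Continuous.aestronglyMeasurable ?_
        have := (hA (θ n)).cont
        fun_prop
      · refine Eventually.of_forall fun n => Eventually.of_forall fun s hs => ?_
        rw [uIoc_of_le hδ.2] at hs
        rw [norm_mul, norm_pow, norm_pow, norm_eq_abs, norm_eq_abs, sq_abs]
        gcongr
        exact hUb _ s ⟨hδ.1.trans hs.1, hs.2⟩
      · refine ContinuousOn.intervalIntegrable ?_
        rw [uIcc_of_le hδ.2]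
        refine (continuousOn_id.pow 2).mul ((continuousOn_const.mul ?_).pow 6)
        exact continuousOn_id.rpow_const fun x hx => Or.inl (hδ.1.trans_le hx.1).ne'
      · refine Eventually.of_forall fun s hs => ?_
        rw [uIoc_of_le hδ.2] at hs
        have hs0 := hδ.1.trans hs.1
        have := ((hUu s ⟨hs0, hs.2⟩).pow 6).const_mul (s ^ 2)
        have e : g s ^ 6 / s ^ 4 = s ^ 2 * u s ^ 6 := by
          simp only [hu]; field_simp
        rwa [e]
    refine le_of_tendsto' h1 fun n => le_trans ?_ (le_max_right _ _)
    have h2 : ∫ r in δ..1, r ^ 2 * U (θ n) r ^ 6 ≤ ∫ r in (0 : ℝ)..1, r ^ 2 * U (θ n) r ^ 6 := by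
      have := (hA (θ n)).cont
      exact intervalIntegral.integral_mono_interval hδ.1.le hδ.2 le_rfl
        (Eventually.of_forall fun r => by positivity)
        (Continuous.intervalIntegrable (by fun_prop) _ _)
    have h3 := (hA (θ n)).bliss
    have h4 : (∫ r in (0 : ℝ)..1, r ^ 2 * U (θ n) r ^ 6) ≤ K * (∫ r in (0 : ℝ)..1, V (θ n) r ^ 2) ^ 3 := by
      rw [hK, div_mul_eq_mul_div, le_div_iff₀ (by positivity)]
      linarith
    exact h2.trans (h4.trans (mul_le_mul_of_nonneg_left (pow_le_pow_left₀ (hE0 _) (hEn _) 3) hKp.le))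

lemma ConcaveOn.mul_le_of_zero {f : ℝ → ℝ} (hf : ConcaveOn ℝ (Icc 0 1) f) (h0 : 0 ≤ f 0) {r t : ℝ}
    (hr : r ∈ Icc (0 : ℝ) 1) (ht : t ∈ Icc (0 : ℝ) 1) : t * f r ≤ f (t * r) := by
  have := hf.2 (left_mem_Icc.2 zero_le_one) hr (sub_nonneg.2 ht.2) ht.1 (by ring)
  simp only [smul_eq_mul, mul_zero, zero_add] at this
  nlinarith [mul_nonneg (sub_nonneg.2 ht.2) h0]

/-- A concave function with finite critical integral is `o(√r)` at the origin. -/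
lemma exists_pow_six_le {f : ℝ → ℝ} {C : ℝ} (hf : ConcaveOn ℝ (Icc 0 1) f)
    (hf0 : ∀ r ∈ Icc (0 : ℝ) 1, 0 ≤ f r) (hfc : ContinuousOn f (Icc 0 1))
    (hC : ∀ δ ∈ Ioc (0 : ℝ) 1, ∫ r in δ..1, f r ^ 6 / r ^ 4 ≤ C) {ε : ℝ} (hε : 0 < ε) :
    ∃ r₀ ∈ Ioc (0 : ℝ) 1, ∀ r ∈ Ioc (0 : ℝ) r₀, f r ^ 6 ≤ ε * r ^ 3 := by
  have h_int : ∀ a ∈ Ioc (0 : ℝ) 1, ∀ b ∈ Ioc (0 : ℝ) 1,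
      IntervalIntegrable (fun r => f r ^ 6 / r ^ 4) MeasureTheory.volume a b := by
    intro a ha b hb
    have hsub : uIcc a b ⊆ Ioc 0 1 := (convex_Ioc (0 : ℝ) 1).ordConnected.uIcc_subset ha hb
    refine ContinuousOn.intervalIntegrable (((hfc.mono (hsub.trans Ioc_subset_Icc_self)).pow 6).div
      (by fun_prop) fun x hx => (pow_pos (hsub hx).1 4).ne')
  set S := (fun δ => ∫ r in δ..1, f r ^ 6 / r ^ 4) '' Ioc (0 : ℝ) 1 with hS
  have hbdd : BddAbove S := ⟨C, by rintro _ ⟨δ, hδ, rfl⟩; exact hC δ hδ⟩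
  have hne : S.Nonempty := ⟨_, 1, right_mem_Ioc.2 one_pos, rfl⟩
  obtain ⟨_, ⟨r₀, hr₀, rfl⟩, hlt⟩ := exists_lt_of_lt_csSup hne
    (sub_lt_self (sSup S) (show 0 < ε / 128 by positivity))
  refine ⟨r₀, hr₀, fun r hr => ?_⟩
  have hr1 : r ≤ 1 := hr.2.trans hr₀.2
  have hrI : r ∈ Ioc (0 : ℝ) 1 := ⟨hr.1, hr1⟩
  have hr2 : r / 2 ∈ Ioc (0 : ℝ) 1 := ⟨half_pos hr.1, by linarith⟩
  have h1 : ∫ s in (r / 2)..1, f s ^ 6 / s ^ 4 ≤ sSup S := le_csSup hbdd ⟨_, hr2, rfl⟩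
  have one_mem : (1 : ℝ) ∈ Ioc (0 : ℝ) 1 := right_mem_Ioc.2 one_pos
  have h2 := intervalIntegral.integral_add_adjacent_intervals (h_int _ hr2 _ hrI) (h_int _ hrI _ one_mem)
  have h3 := intervalIntegral.integral_add_adjacent_intervals (h_int _ hrI _ hr₀) (h_int _ hr₀ _ one_mem)
  have h4 : 0 ≤ ∫ s in r..r₀, f s ^ 6 / s ^ 4 :=
    intervalIntegral.integral_nonneg hr.2 fun s hs => by positivity
  have h5 : ∫ s in (r / 2)..r, (f r / 2) ^ 6 / r ^ 4 ≤ ∫ s in (r / 2)..r, f s ^ 6 / s ^ 4 := by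
    refine intervalIntegral.integral_mono_on (by linarith [hr.1])
      (continuous_const.intervalIntegrable _ _) (h_int _ hr2 _ hrI) fun s hs => ?_
    have hs0 : 0 < s := hr2.1.trans_le hs.1
    have h6 := hf.mul_le_of_zero (hf0 0 (by simp)) (Ioc_subset_Icc_self hrI) (t := s / r)
      ⟨by have := hr.1; positivity, (div_le_one hr.1).2 hs.2⟩
    rw [div_mul_cancel₀ _ hr.1.ne'] at h6
    have h7 : f r / 2 ≤ s / r * f r := by
      have : 1 / 2 ≤ s / r := by rw [le_div_iff₀ hr.1]; linarith [hs.1]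
      nlinarith [hf0 r (Ioc_subset_Icc_self hrI)]
    have h8 := hf0 r (Ioc_subset_Icc_self hrI)
    gcongr
    exacts [h7.trans h6, hs.2]
  rw [intervalIntegral.integral_const, smul_eq_mul] at h5
  have h9 : (r - r / 2) * ((f r / 2) ^ 6 / r ^ 4) = f r ^ 6 / r ^ 3 / 128 := by
    have := hr.1.ne'
    field_simp; ring
  rw [h9] at h5
  have h10 : f r ^ 6 / r ^ 3 ≤ ε := by linarith
  rwa [div_le_iff₀ (pow_pos hr.1 3)] at h10

/-- Linear decay improvement for a subcritical integral inequality. -/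
lemma exists_le_rpow_of_integral_le {f p : ℝ → ℝ} {B C : ℝ} (hB : 0 < B)
    (hp : ContinuousOn p (Ioc 0 1)) (hp0 : ∀ s ∈ Ioc (0 : ℝ) 1, 0 ≤ p s)
    (hfC : ∀ r ∈ Ioc (0 : ℝ) 1, f r ≤ C * √r)
    (hpint : IntervalIntegrable (fun s => s * p s) MeasureTheory.volume 0 1)
    (hf : ∀ r ∈ Ioc (0 : ℝ) 1, f r ≤ B * ((∫ s in (0 : ℝ)..r, s * p s) + r * ∫ s in r..1, p s))
    (hsmall : ∀ ε > 0, ∃ r₀ ∈ Ioc (0 : ℝ) 1, ∀ s ∈ Ioc (0 : ℝ) r₀, p s ≤ ε * s ^ (-2 : ℝ) * f s) :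
    ∃ C', ∀ r ∈ Ioc (0 : ℝ) 1, f r ≤ C' * r ^ (3 / 4 : ℝ) := by
  set ε := 3 / (32 * B) with hε
  have hεp : 0 < ε := by positivity
  obtain ⟨r₀, hr₀, hr₀p⟩ := hsmall ε hεp
  have one_mem : (1 : ℝ) ∈ Ioc (0 : ℝ) 1 := right_mem_Ioc.2 one_pos
  have h_int : ∀ a ∈ Ioc (0 : ℝ) 1, ∀ b ∈ Ioc (0 : ℝ) 1,
      IntervalIntegrable p MeasureTheory.volume a b := fun a ha b hb =>
    ContinuousOn.intervalIntegrable
      (hp.mono ((convex_Ioc (0 : ℝ) 1).ordConnected.uIcc_subset ha hb))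
  set P := ∫ s in r₀..1, p s with hP
  have hP0 : 0 ≤ P :=
    intervalIntegral.integral_nonneg hr₀.2 fun s hs => hp0 s ⟨hr₀.1.trans_le hs.1, hs.2⟩
  have step : ∀ η > 0, ∀ b ≥ 0,
      (∀ r ∈ Ioc (0 : ℝ) r₀, f r ≤ b * (r ^ (3 / 4 : ℝ) + η * r ^ (1 / 4 : ℝ))) →
      ∀ r ∈ Ioc (0 : ℝ) r₀, f r ≤ (b / 2 + B * P) * (r ^ (3 / 4 : ℝ) + η * r ^ (1 / 4 : ℝ)) := by
    intro η hη b hb hfb r hr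
    have hrI : r ∈ Ioc (0 : ℝ) 1 := ⟨hr.1, hr.2.trans hr₀.2⟩
    have hpb : ∀ s ∈ Ioc (0 : ℝ) r₀, p s ≤ ε * b * (s ^ (-(5 / 4) : ℝ) + η * s ^ (-(7 / 4) : ℝ)) := by
      intro s hs
      refine (hr₀p s hs).trans ?_
      calc ε * s ^ (-2 : ℝ) * f s
          ≤ ε * s ^ (-2 : ℝ) * (b * (s ^ (3 / 4 : ℝ) + η * s ^ (1 / 4 : ℝ))) := by
            have := rpow_nonneg hs.1.le (-2)
            gcongr
            exact hfb s hs
        _ = ε * b * (s ^ (-2 : ℝ) * s ^ (3 / 4 : ℝ) + η * (s ^ (-2 : ℝ) * s ^ (1 / 4 : ℝ))) := by ring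
        _ = _ := by rw [← rpow_add hs.1, ← rpow_add hs.1]; norm_num
    have i1 : ∫ s in (0 : ℝ)..r, s * p s
        ≤ ε * b * (4 / 3 * r ^ (3 / 4 : ℝ) + 4 * η * r ^ (1 / 4 : ℝ)) := by
      have hI1 : IntervalIntegrable (fun s : ℝ => s ^ (-(1 / 4) : ℝ)) MeasureTheory.volume 0 r :=
        intervalIntegral.intervalIntegrable_rpow' (by norm_num)
      have hI2 : IntervalIntegrable (fun s : ℝ => s ^ (-(3 / 4) : ℝ)) MeasureTheory.volume 0 r :=
        intervalIntegral.intervalIntegrable_rpow' (by norm_num)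
      calc ∫ s in (0 : ℝ)..r, s * p s
          ≤ ∫ s in (0 : ℝ)..r, ε * b * (s ^ (-(1 / 4) : ℝ) + η * s ^ (-(3 / 4) : ℝ)) := by
            refine intervalIntegral.integral_mono_on_of_le_Ioo hr.1.le ?_
              ((hI1.add (hI2.const_mul η)).const_mul _) fun s hs => ?_
            · exact hpint.mono_set (by
                rw [uIcc_of_le hr.1.le, uIcc_of_le zero_le_one]; exact Icc_subset_Icc_right hrI.2)
            · have hs0 := hs.1
              calc s * p s ≤ s * (ε * b * (s ^ (-(5 / 4) : ℝ) + η * s ^ (-(7 / 4) : ℝ))) := by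
                    gcongr; exact hpb s ⟨hs.1, hs.2.le.trans hr.2⟩
                _ = ε * b * (s ^ (1 : ℝ) * s ^ (-(5 / 4) : ℝ)
                    + η * (s ^ (1 : ℝ) * s ^ (-(7 / 4) : ℝ))) := by rw [rpow_one]; ring
                _ = _ := by rw [← rpow_add hs.1, ← rpow_add hs.1]; norm_num
        _ = _ := by
            rw [intervalIntegral.integral_const_mul, intervalIntegral.integral_add hI1
              (hI2.const_mul η), intervalIntegral.integral_const_mul,
              integral_rpow (Or.inl (by norm_num)), integral_rpow (Or.inl (by norm_num))]
            norm_num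
            left
            ring
    have i2 : r * ∫ s in r..r₀, p s
        ≤ ε * b * (4 * r ^ (3 / 4 : ℝ) + 4 / 3 * η * r ^ (1 / 4 : ℝ)) := by
      have h0 : (0 : ℝ) ∉ uIcc r r₀ := by rw [uIcc_of_le hr.2]; exact fun h => hr.1.not_ge h.1
      have hI1 : IntervalIntegrable (fun s : ℝ => s ^ (-(5 / 4) : ℝ)) MeasureTheory.volume r r₀ :=
        intervalIntegral.intervalIntegrable_rpow (Or.inr h0)
      have hI2 : IntervalIntegrable (fun s : ℝ => s ^ (-(7 / 4) : ℝ)) MeasureTheory.volume r r₀ :=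
        intervalIntegral.intervalIntegrable_rpow (Or.inr h0)
      have hr0 := hr.1
      calc r * ∫ s in r..r₀, p s
          ≤ r * ∫ s in r..r₀, ε * b * (s ^ (-(5 / 4) : ℝ) + η * s ^ (-(7 / 4) : ℝ)) := by
            gcongr
            refine intervalIntegral.integral_mono_on hr.2 (h_int _ hrI _ hr₀)
              ((hI1.add (hI2.const_mul η)).const_mul _) fun s hs =>
              hpb s ⟨hr.1.trans_le hs.1, hs.2⟩
        _ = ε * b * (4 * (r * r ^ (-(1 / 4) : ℝ) - r * r₀ ^ (-(1 / 4) : ℝ))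
            + 4 / 3 * η * (r * r ^ (-(3 / 4) : ℝ) - r * r₀ ^ (-(3 / 4) : ℝ))) := by
            rw [intervalIntegral.integral_const_mul, intervalIntegral.integral_add hI1
              (hI2.const_mul η), intervalIntegral.integral_const_mul,
              integral_rpow (Or.inr ⟨by norm_num, h0⟩), integral_rpow (Or.inr ⟨by norm_num, h0⟩)]
            norm_num
            ring
        _ ≤ ε * b * (4 * (r * r ^ (-(1 / 4) : ℝ)) + 4 / 3 * η * (r * r ^ (-(3 / 4) : ℝ))) := by
            have h1 := rpow_nonneg hr₀.1.le (-(1 / 4))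
            have h2 := rpow_nonneg hr₀.1.le (-(3 / 4))
            gcongr
            · exact sub_le_self _ (by positivity)
            · exact sub_le_self _ (by positivity)
        _ = ε * b * (4 * (r ^ (1 : ℝ) * r ^ (-(1 / 4) : ℝ))
            + 4 / 3 * η * (r ^ (1 : ℝ) * r ^ (-(3 / 4) : ℝ))) := by rw [rpow_one]
        _ = _ := by rw [← rpow_add hr.1, ← rpow_add hr.1]; norm_num
    have i3 : r * P ≤ P * r ^ (3 / 4 : ℝ) := by
      rw [mul_comm]
      gcongr
      nth_rw 1 [← rpow_one r]
      exact rpow_le_rpow_of_exponent_ge hr.1 hrI.2 (by norm_num)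
    have hsplit := intervalIntegral.integral_add_adjacent_intervals (h_int _ hrI _ hr₀)
      (h_int _ hr₀ _ one_mem)
    have hq : 0 ≤ P * (η * r ^ (1 / 4 : ℝ)) := by
      have := rpow_nonneg hr.1.le (1 / 4)
      positivity
    calc f r ≤ B * ((∫ s in (0 : ℝ)..r, s * p s) + r * ∫ s in r..1, p s) := hf r hrI
      _ ≤ B * (ε * b * (16 / 3) * (r ^ (3 / 4 : ℝ) + η * r ^ (1 / 4 : ℝ))
          + P * (r ^ (3 / 4 : ℝ) + η * r ^ (1 / 4 : ℝ))) := by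
          rw [← hsplit]
          refine mul_le_mul_of_nonneg_left ?_ hB.le
          linarith
      _ = _ := by rw [hε]; field_simp; ring
  have hC0 : f r₀ ≤ |C| * √r₀ := (hfC r₀ hr₀).trans (by gcongr; exact le_abs_self C)
  have lim1 : ∀ η > 0, ∀ r ∈ Ioc (0 : ℝ) r₀,
      f r ≤ 2 * (B * P) * (r ^ (3 / 4 : ℝ) + η * r ^ (1 / 4 : ℝ)) := by
    intro η hη
    have iter : ∀ n : ℕ, ∀ r ∈ Ioc (0 : ℝ) r₀, f r ≤ (2 * (B * P) + |C| / η * (1 / 2) ^ n)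
        * (r ^ (3 / 4 : ℝ) + η * r ^ (1 / 4 : ℝ)) := by
      intro n
      induction n with
      | zero =>
        intro r hr
        have hr1 : r ≤ 1 := hr.2.trans hr₀.2
        have h34 := rpow_nonneg hr.1.le (3 / 4)
        have h14 := rpow_nonneg hr.1.le (1 / 4)
        have : √r ≤ r ^ (1 / 4 : ℝ) := by
          rw [sqrt_eq_rpow]
          exact rpow_le_rpow_of_exponent_ge hr.1 hr1 (by norm_num)
        calc f r ≤ |C| * √r := (hfC r ⟨hr.1, hr1⟩).trans (by gcongr; exact le_abs_self C)
          _ ≤ |C| * r ^ (1 / 4 : ℝ) := by gcongr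
          _ = |C| / η * (η * r ^ (1 / 4 : ℝ)) := by field_simp
          _ ≤ _ := by
            have : 0 ≤ B * P := by positivity
            gcongr
            · simp only [pow_zero, mul_one]; linarith
            · linarith
      | succ n ih =>
        intro r hr
        have := step η hη _ (by positivity) ih r hr
        refine this.trans_eq ?_
        ring
    intro r hr
    have ht : Tendsto (fun n : ℕ => (2 * (B * P) + |C| / η * (1 / 2 : ℝ) ^ n)
        * (r ^ (3 / 4 : ℝ) + η * r ^ (1 / 4 : ℝ))) atTop
        (𝓝 ((2 * (B * P) + |C| / η * 0) * (r ^ (3 / 4 : ℝ) + η * r ^ (1 / 4 : ℝ)))) :=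
      (((tendsto_pow_atTop_nhds_zero_of_lt_one (by norm_num) (by norm_num)).const_mul _).const_add
        _).mul_const _
    have := ge_of_tendsto' ht fun n => iter n r hr
    simpa using this
  have lim2 : ∀ r ∈ Ioc (0 : ℝ) r₀, f r ≤ 2 * (B * P) * r ^ (3 / 4 : ℝ) := by
    intro r hr
    have hcont : Continuous fun η : ℝ => 2 * (B * P) * (r ^ (3 / 4 : ℝ) + η * r ^ (1 / 4 : ℝ)) := by
      fun_prop
    have ht := (hcont.tendsto 0).mono_left (nhdsWithin_le_nhds (s := Ioi 0))
    have := ge_of_tendsto ht (eventually_nhdsWithin_of_forall fun η hη => lim1 η hη r hr)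
    simpa using this
  refine ⟨max (2 * (B * P)) (|C| / r₀ ^ (3 / 4 : ℝ)), fun r hr => ?_⟩
  have hrp := rpow_nonneg hr.1.le (3 / 4)
  rcases le_or_gt r r₀ with h | h
  · exact (lim2 r ⟨hr.1, h⟩).trans (by gcongr; exact le_max_left _ _)
  · have h1 : √r ≤ 1 := by rw [Real.sqrt_le_one]; exact hr.2
    have h2 : r₀ ^ (3 / 4 : ℝ) ≤ r ^ (3 / 4 : ℝ) := rpow_le_rpow hr₀.1.le h.le (by norm_num)
    have h3 : 0 < r₀ ^ (3 / 4 : ℝ) := rpow_pos_of_pos hr₀.1 _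
    calc f r ≤ |C| * √r := (hfC r hr).trans (by gcongr; exact le_abs_self C)
      _ ≤ |C| * 1 := by gcongr
      _ = |C| / r₀ ^ (3 / 4 : ℝ) * r₀ ^ (3 / 4 : ℝ) := by field_simp
      _ ≤ _ := by
        gcongr
        exact le_max_right _ _

lemma GreenPair.sol_congr {lam : ℝ} (G : GreenPair lam) {p q : ℝ → ℝ}
    (h : ∀ s ∈ Icc (0 : ℝ) 1, p s = q s) : ∀ r ∈ Icc (0 : ℝ) 1, G.sol p r = G.sol q r := by
  intro r hr
  unfold GreenPair.sol
  congr 2 <;> refine intervalIntegral.integral_congr fun s hs => ?_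
  · rw [uIcc_of_le hr.1] at hs
    simp only [h s ⟨hs.1, hs.2.trans hr.2⟩]
  · rw [uIcc_of_le hr.2] at hs
    simp only [h s ⟨hr.1.trans hs.1, hs.2⟩]

lemma intervalIntegrable_of_le_rpow {g : ℝ → ℝ} {C e : ℝ} (he : -1 < e)
    (hg : ContinuousOn g (Ioc 0 1)) (h0 : ∀ s ∈ Ioc (0 : ℝ) 1, 0 ≤ g s)
    (hle : ∀ s ∈ Ioc (0 : ℝ) 1, g s ≤ C * s ^ e) :
    IntervalIntegrable g MeasureTheory.volume 0 1 := by
  refine ((intervalIntegral.intervalIntegrable_rpow' he).const_mul C).mono_fun' ?_ ?_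
  · rw [uIoc_of_le zero_le_one]
    exact hg.aestronglyMeasurable measurableSet_Ioc
  · rw [uIoc_of_le zero_le_one]
    refine (MeasureTheory.ae_restrict_iff' measurableSet_Ioc).2 (Eventually.of_forall fun s hs => ?_)
    beta_reduce
    rw [norm_eq_abs, abs_of_nonneg (h0 s hs)]
    exact hle s hs

lemma GreenPair.exists_sol_le {lam : ℝ} (G : GreenPair lam) :
    ∃ B, 0 < B ∧ ∀ p : ℝ → ℝ, ContinuousOn p (Ioc 0 1) → (∀ s ∈ Ioc (0 : ℝ) 1, 0 ≤ p s) →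
      IntervalIntegrable (fun s => s * p s) MeasureTheory.volume 0 1 →
      ∀ r ∈ Ioc (0 : ℝ) 1,
        G.sol p r ≤ B * ((∫ s in (0 : ℝ)..r, s * p s) + r * ∫ s in r..1, p s) := by
  obtain ⟨A, hA, hα, hβ⟩ := G.exists_bound
  refine ⟨A ^ 2, by positivity, fun p hp hp0 h_int r hr => ?_⟩
  have hrI := Ioc_subset_Icc_self hr
  have hsub : uIcc 0 r ⊆ uIcc 0 1 := by
    rw [uIcc_of_le hr.1.le, uIcc_of_le zero_le_one]; exact Icc_subset_Icc_right hr.2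
  have hmem : ∀ s ∈ Icc r 1, s ∈ Ioc (0 : ℝ) 1 := fun s hs => ⟨hr.1.trans_le hs.1, hs.2⟩
  have h1 : ∫ s in (0 : ℝ)..r, G.α s * p s ≤ A * ∫ s in (0 : ℝ)..r, s * p s := by
    rw [← intervalIntegral.integral_const_mul]
    have hb : ∀ s ∈ Ioc (0 : ℝ) 1, G.α s * p s ≤ A * (s * p s) := fun s hs => by
      rw [← mul_assoc]
      exact mul_le_mul_of_nonneg_right (hα s (Ioc_subset_Icc_self hs)) (hp0 s hs)
    refine intervalIntegral.integral_mono_on_of_le_Ioo hr.1.le ?_ ((h_int.mono_set hsub).const_mul A)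
      fun s hs => hb s ⟨hs.1, hs.2.le.trans hr.2⟩
    refine IntervalIntegrable.mono_set ?_ hsub
    refine (h_int.const_mul A).mono_fun' ?_ ?_
    · rw [uIoc_of_le zero_le_one]
      exact (G.continuous_α.continuousOn.mul hp).aestronglyMeasurable measurableSet_Ioc
    · rw [uIoc_of_le zero_le_one]
      refine (MeasureTheory.ae_restrict_iff' measurableSet_Ioc).2
        (Eventually.of_forall fun s hs => ?_)
      beta_reduce
      rw [norm_eq_abs, abs_of_nonneg (mul_nonneg (G.α_nonneg s (Ioc_subset_Icc_self hs)) (hp0 s hs))]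
      exact hb s hs
  have h2 : ∫ s in r..1, G.β s * p s ≤ A * ∫ s in r..1, p s := by
    rw [← intervalIntegral.integral_const_mul]
    have hpc : ContinuousOn p (uIcc r 1) := by
      rw [uIcc_of_le hr.2]; exact hp.mono hmem
    refine intervalIntegral.integral_mono_on hr.2
      (G.continuous_β.continuousOn.mul hpc).intervalIntegrable
      (continuousOn_const.mul hpc).intervalIntegrable fun s hs => ?_
    exact mul_le_mul_of_nonneg_right (hβ s (Ioc_subset_Icc_self (hmem s hs))) (hp0 s (hmem s hs))
  have h3 : 0 ≤ ∫ s in (0 : ℝ)..r, s * p s := by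
    rw [intervalIntegral.integral_of_le hr.1.le]
    exact MeasureTheory.setIntegral_nonneg measurableSet_Ioc fun s hs =>
      mul_nonneg hs.1.le (hp0 s ⟨hs.1, hs.2.trans hr.2⟩)
  have h4 : 0 ≤ ∫ s in r..1, p s :=
    intervalIntegral.integral_nonneg hr.2 fun s hs => hp0 s (hmem s hs)
  calc G.sol p r ≤ A * (A * ∫ s in (0 : ℝ)..r, s * p s) + A * r * (A * ∫ s in r..1, p s) := by
        refine add_le_add ?_ ?_
        · exact (mul_le_mul_of_nonneg_left h1 (G.β_nonneg r hrI)).trans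
            (mul_le_mul_of_nonneg_right (hβ r hrI) (by positivity))
        · exact (mul_le_mul_of_nonneg_left h2 (G.α_nonneg r hrI)).trans
            (mul_le_mul_of_nonneg_right (hα r hrI) (by positivity))
    _ = _ := by ring

lemma integral_add_mul_integral_le {p : ℝ → ℝ} (hp0 : ∀ s ∈ Ioc (0 : ℝ) 1, 0 ≤ p s)
    (h_int : IntervalIntegrable p MeasureTheory.volume 0 1) {r : ℝ} (hr : r ∈ Ioc (0 : ℝ) 1) :
    (∫ s in (0 : ℝ)..r, s * p s) + r * ∫ s in r..1, p s ≤ r * ∫ s in (0 : ℝ)..1, p s := by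
  have i1 : IntervalIntegrable p MeasureTheory.volume 0 r := h_int.mono_set (by
    rw [uIcc_of_le hr.1.le, uIcc_of_le zero_le_one]; exact Icc_subset_Icc_right hr.2)
  have i2 : IntervalIntegrable p MeasureTheory.volume r 1 := h_int.mono_set (by
    rw [uIcc_of_le hr.2, uIcc_of_le zero_le_one]; exact Icc_subset_Icc_left hr.1.le)
  have h1 : ∫ s in (0 : ℝ)..r, s * p s ≤ ∫ s in (0 : ℝ)..r, r * p s :=
    intervalIntegral.integral_mono_on_of_le_Ioo hr.1.le
      (i1.continuousOn_mul continuousOn_id) (i1.const_mul r)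
      fun s hs => mul_le_mul_of_nonneg_right hs.2.le (hp0 s ⟨hs.1, hs.2.le.trans hr.2⟩)
  rw [← intervalIntegral.integral_add_adjacent_intervals i1 i2]
  rw [intervalIntegral.integral_const_mul] at h1
  linarith

lemma dslope_pos_of_concaveOn {g : ℝ → ℝ} (hc : Continuous (dslope g 0))
    (hg : ConcaveOn ℝ (Icc 0 1) g) (h0 : g 0 = 0) (h1 : g 1 = 0)
    (hpos : ∃ r ∈ Icc (0 : ℝ) 1, 0 < g r) : ∀ r ∈ Ico (0 : ℝ) 1, 0 < dslope g 0 r := by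
  obtain ⟨r₀, hr₀, hgr⟩ := hpos
  have hr0 : 0 < r₀ := hr₀.1.lt_of_ne (by rintro rfl; linarith)
  have hr1 : r₀ < 1 := hr₀.2.lt_of_ne (by rintro rfl; linarith)
  have hm : ∀ r, r * dslope g 0 r = g r := fun r => by
    simpa [h0] using sub_smul_dslope g 0 r
  have hsmall : ∀ r ∈ Ioo (0 : ℝ) r₀, g r₀ / r₀ ≤ dslope g 0 r := by
    intro r hr
    have := hg.mul_le_of_zero h0.ge hr₀ (t := r / r₀)
      ⟨(div_pos hr.1 hr0).le, (div_le_one hr0).2 hr.2.le⟩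
    rw [div_mul_cancel₀ _ hr0.ne', ← hm r] at this
    refine le_of_mul_le_mul_left (a := r) ?_ hr.1
    calc r * (g r₀ / r₀) = r / r₀ * g r₀ := by ring
      _ ≤ _ := this
  have hcl : IsClosed {r | g r₀ / r₀ ≤ dslope g 0 r} := isClosed_le continuous_const hc
  have hsmall' := closure_minimal (s := Ioo (0 : ℝ) r₀) hsmall hcl
  rw [closure_Ioo hr0.ne] at hsmall'
  intro r hr
  rcases le_or_gt r r₀ with h | h
  · exact (div_pos hgr hr0).trans_le (hsmall' ⟨hr.1, h⟩)
  · have hrp : 0 < r := hr0.trans h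
    have hne : 1 - r₀ ≠ 0 := by linarith
    have ha : 0 ≤ (1 - r) / (1 - r₀) := div_nonneg (by linarith [hr.2]) (by linarith)
    have hb : 0 ≤ (r - r₀) / (1 - r₀) := div_nonneg (by linarith) (by linarith)
    have h2 := hg.2 hr₀ (right_mem_Icc.2 zero_le_one) ha hb (by field_simp; ring)
    have h3 : (1 - r) / (1 - r₀) * r₀ + (r - r₀) / (1 - r₀) * 1 = r := by
      field_simp; ring
    simp only [smul_eq_mul] at h2
    rw [h3, h1, mul_zero, add_zero] at h2
    have h4 : 0 < (1 - r) / (1 - r₀) * g r₀ :=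
      mul_pos (div_pos (by linarith [hr.2]) (by linarith)) hgr
    refine pos_of_mul_pos_right (a := r) ?_ hrp.le
    rw [hm]
    linarith

lemma concaveOn_pot {u : ℝ → ℝ} (hu : Continuous u) (hu0 : ∀ r ∈ Icc (0 : ℝ) 1, 0 ≤ u r) :
    ConcaveOn ℝ (Icc 0 1) (pot u) := by
  have hder : deriv (pot u) = pot' u := funext fun r => (hasDerivAt_pot hu r).deriv
  refine concaveOn_of_deriv2_nonpos (convex_Icc 0 1) (continuous_pot hu).continuousOn
    (fun r _ => (hasDerivAt_pot hu r).differentiableAt.differentiableWithinAt)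
    (by rw [hder]
        exact fun r _ => (hasDerivAt_pot' hu r).differentiableAt.differentiableWithinAt)
    fun r hr => ?_
  have hr' := interior_subset hr
  rw [Function.iterate_succ, Function.iterate_one, Function.comp_apply, hder,
    (hasDerivAt_pot' hu r).deriv]
  exact neg_nonpos.2 (mul_nonneg hr'.1 (pow_nonneg (hu0 r hr') 5))

lemma pot_half_pos {u : ℝ → ℝ} (hu : Continuous u) (hu0 : ∀ r ∈ Ico (0 : ℝ) 1, 0 < u r) :
    0 < pot u (1 / 2) := by
  have hc := continuous_srcF hu
  have h1 : 0 < ∫ s in (0 : ℝ)..(1 / 2), s * srcF u s := by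
    refine intervalIntegral.intervalIntegral_pos_of_pos_on
      ((continuous_id.mul hc).intervalIntegrable _ _) (fun s hs => ?_) (by norm_num)
    have := hu0 s ⟨hs.1.le, hs.2.trans (by norm_num)⟩
    have hs0 := hs.1
    unfold srcF
    positivity
  have h2 : 0 ≤ ∫ s in (1 / 2 : ℝ)..1, (1 - s) * srcF u s := by
    rw [intervalIntegral.integral_of_le (by norm_num), MeasureTheory.integral_Ioc_eq_integral_Ioo]
    refine MeasureTheory.setIntegral_nonneg measurableSet_Ioo fun s hs => ?_
    have hs0 : 0 < s := by linarith [hs.1]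
    exact mul_nonneg (sub_nonneg.2 hs.2.le) (mul_nonneg hs0.le (pow_nonneg (hu0 s ⟨hs0.le, hs.2⟩).le 5))
  have : pot u (1 / 2) = (1 - 1 / 2) * (∫ s in (0 : ℝ)..(1 / 2), s * srcF u s)
    + 1 / 2 * ∫ s in (1 / 2 : ℝ)..1, (1 - s) * srcF u s := rfl
  rw [this]
  norm_num at h1 h2 ⊢
  linarith

lemma continuousOn_of_holder {f : ℝ → ℝ} {s : Set ℝ} {C : ℝ}
    (h : ∀ a ∈ s, ∀ b ∈ s, |f a - f b| ≤ C * √|a - b|) : ContinuousOn f s := by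
  intro a ha
  have hc : Continuous fun b => C * √|b - a| := by fun_prop
  have h0 : Tendsto (fun b => C * √|b - a|) (𝓝[s] a) (𝓝 0) := by
    simpa using (hc.tendsto a).mono_left nhdsWithin_le_nhds
  exact tendsto_iff_dist_tendsto_zero.2 (squeeze_zero' (Eventually.of_forall fun _ => dist_nonneg)
    (eventually_nhdsWithin_of_forall fun b hb => h b hb a ha) h0)

/-- The limit profile is a positive continuous radial solution. -/
theorem exists_regular_profile {lam c : ℝ} (G : GreenPair lam) (hlam : 0 ≤ lam) (hc : 0 < c)
    (hco : Coercive lam c) {u₀ f₀' : ℝ → ℝ} (h₀ : Adm u₀ f₀') (hQ₀ : quad lam u₀ f₀' = 1)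
    (hD₀ : (256 / (27 * π ^ 2)) ^ 2 < dbl u₀) :
    ∃ (u : ℝ → ℝ) (M : ℝ), 0 < M ∧ Continuous u ∧
      (∀ r ∈ Icc (0 : ℝ) 1, G.sol (srcP u) r = M * (r * u r)) ∧
      (∀ r ∈ Ico (0 : ℝ) 1, 0 < u r) ∧ ∀ r ∈ Ico (0 : ℝ) 1, 0 < dslope (pot u) 0 r := by
  obtain ⟨f, M, C, hM, heq, hconc, hf0, hpos, hfH, hpot0, hpotH, h_int⟩ :=
    exists_limit_profile G hlam hc hco h₀ hQ₀ hD₀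
  set w : ℝ → ℝ := fun s => f s / s with hw
  have z0 : (0 : ℝ) ∈ Icc (0 : ℝ) 1 := left_mem_Icc.2 zero_le_one
  have z1 : (1 : ℝ) ∈ Icc (0 : ℝ) 1 := right_mem_Icc.2 zero_le_one
  have f_zero : f 0 = 0 := by simpa [hM.ne'] using heq 0 z0
  have f_one : f 1 = 0 := by simpa [hM.ne'] using heq 1 z1
  have hC : 0 ≤ C := by simpa using (abs_nonneg _).trans (hfH 1 z1 0 z0)
  have hfc := continuousOn_of_holder hfH
  have hpc := continuousOn_of_holder hpotH
  have hfC : ∀ r ∈ Ioc (0 : ℝ) 1, f r ≤ C * √r := fun r hr => by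
    have := hfH r (Ioc_subset_Icc_self hr) 0 z0
    rw [f_zero, sub_zero, sub_zero, abs_of_pos hr.1] at this
    exact (le_abs_self _).trans this
  have hpC : ∀ r ∈ Ioc (0 : ℝ) 1, pot w r ≤ C * √r := fun r hr => by
    have := hpotH r (Ioc_subset_Icc_self hr) 0 z0
    rw [pot_zero, sub_zero, sub_zero, abs_of_pos hr.1] at this
    exact (le_abs_self _).trans this
  have hw0 : ∀ s ∈ Ioc (0 : ℝ) 1, 0 ≤ w s := fun s hs =>
    div_nonneg (hf0 s (Ioc_subset_Icc_self hs)) hs.1.le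
  have hwc : ContinuousOn w (Ioc 0 1) :=
    (hfc.mono Ioc_subset_Icc_self).div continuousOn_id fun s hs => hs.1.ne'
  have hPc : ContinuousOn (srcP w) (Ioc 0 1) := (hwc.pow 4).mul (hpc.mono Ioc_subset_Icc_self)
  have hP0 : ∀ s ∈ Ioc (0 : ℝ) 1, 0 ≤ srcP w s := fun s hs =>
    mul_nonneg (pow_nonneg (hw0 s hs) 4) (hpot0 s (Ioc_subset_Icc_self hs))
  have hFc : ContinuousOn (srcF w) (Ioc 0 1) := continuousOn_id.mul (hwc.pow 5)
  have hF0 : ∀ s ∈ Ioc (0 : ℝ) 1, 0 ≤ srcF w s := fun s hs =>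
    mul_nonneg hs.1.le (pow_nonneg (hw0 s hs) 5)
  obtain ⟨B, hB, hsol⟩ := G.exists_sol_le
  obtain ⟨B', hB', hsol'⟩ := GreenPair.laplace.exists_sol_le
  have hPint : IntervalIntegrable (fun s => s * srcP w s) MeasureTheory.volume 0 1 := by
    refine intervalIntegrable_of_le_rpow (C := C ^ 5) (e := -(1 / 2)) (by norm_num)
      (continuousOn_id.mul hPc) (fun s hs => mul_nonneg hs.1.le (hP0 s hs)) fun s hs => ?_
    have hs0 := hs.1
    have h1 := hf0 s (Ioc_subset_Icc_self hs)
    have h2 := hpot0 s (Ioc_subset_Icc_self hs)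
    calc s * srcP w s = s * ((f s / s) ^ 4 * pot w s) := rfl
      _ ≤ s * ((C * √s / s) ^ 4 * (C * √s)) := by
        gcongr
        exacts [hfC s hs, hpC s hs]
      _ = C ^ 5 * ((√s ^ 2) ^ 2 * √s / s ^ 3) := by field_simp
      _ = C ^ 5 * (√s * √s / (s * √s)) := by
        rw [sq_sqrt hs0.le, mul_self_sqrt hs0.le]
        have : √s ≠ 0 := (sqrt_pos.2 hs0).ne'
        field_simp
        rw [sq_sqrt hs0.le]
      _ = C ^ 5 * s ^ (-(1 / 2) : ℝ) := by
        rw [mul_self_sqrt hs0.le, rpow_neg hs0.le, ← sqrt_eq_rpow]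
        field_simp
  have hfle : ∀ r ∈ Ioc (0 : ℝ) 1, f r
      ≤ B / M * ((∫ s in (0 : ℝ)..r, s * srcP w s) + r * ∫ s in r..1, srcP w s) := fun r hr => by
    have h1 := hsol _ hPc hP0 hPint r hr
    rw [← heq r (Ioc_subset_Icc_self hr)] at h1
    rw [div_mul_eq_mul_div, le_div_iff₀ hM]
    linarith
  have hsmall : ∀ ε > 0, ∃ r₀ ∈ Ioc (0 : ℝ) 1, ∀ s ∈ Ioc (0 : ℝ) r₀,
      srcP w s ≤ ε * s ^ (-2 : ℝ) * f s := by
    intro ε hε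
    obtain ⟨r₀, hr₀, h⟩ := exists_pow_six_le hconc hf0 hfc h_int
      (show 0 < (ε / (C + 1)) ^ 2 by positivity)
    refine ⟨r₀, hr₀, fun s hs => ?_⟩
    have hs' : s ∈ Ioc (0 : ℝ) 1 := ⟨hs.1, hs.2.trans hr₀.2⟩
    have hs0 := hs.1
    have h1 := hf0 s (Ioc_subset_Icc_self hs')
    have h2 : f s ^ 3 ≤ ε / (C + 1) * (s * √s) := by
      refine le_of_sq_le_sq ?_ (by positivity)
      calc (f s ^ 3) ^ 2 = f s ^ 6 := by ring
        _ ≤ _ := h s hs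
        _ = (ε / (C + 1)) ^ 2 * (s ^ 2 * √s ^ 2) := by rw [sq_sqrt hs0.le]; ring
        _ = _ := by ring
    calc srcP w s = (f s / s) ^ 4 * pot w s := rfl
      _ ≤ (f s / s) ^ 4 * ((C + 1) * √s) := by
        gcongr
        exact (hpC s hs').trans (by gcongr; linarith)
      _ = f s ^ 3 * (C + 1) * √s / s ^ 4 * f s := by field_simp
      _ ≤ ε / (C + 1) * (s * √s) * (C + 1) * √s / s ^ 4 * f s := by gcongr
      _ = ε * (√s ^ 2 / s ^ 3) * f s := by field_simp
      _ = ε * s ^ (-2 : ℝ) * f s := by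
        rw [sq_sqrt hs0.le, rpow_neg hs0.le, rpow_two]
        field_simp
  obtain ⟨C₁, hC₁⟩ := exists_le_rpow_of_integral_le (div_pos hB hM) hPc hP0 hfC hPint hfle hsmall
  have hPint' : IntervalIntegrable (srcP w) MeasureTheory.volume 0 1 := by
    refine intervalIntegrable_of_le_rpow (C := |C₁| ^ 4 * C) (e := -(1 / 2)) (by norm_num)
      hPc hP0 fun s hs => ?_
    have hs0 := hs.1
    have h1 := hf0 s (Ioc_subset_Icc_self hs)
    have h3 : f s ≤ |C₁| * s ^ (3 / 4 : ℝ) :=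
      (hC₁ s hs).trans (mul_le_mul_of_nonneg_right (le_abs_self _) (rpow_nonneg hs0.le _))
    calc srcP w s = (f s / s) ^ 4 * pot w s := rfl
      _ ≤ (|C₁| * s ^ (3 / 4 : ℝ) / s) ^ 4 * (C * √s) := by
        gcongr
        exacts [hpot0 s (Ioc_subset_Icc_self hs), hpC s hs]
      _ = |C₁| ^ 4 * C * ((s ^ (3 / 4 : ℝ)) ^ 4 * s ^ (1 / 2 : ℝ) / s ^ 4) := by
        rw [sqrt_eq_rpow]; field_simp
      _ = _ := by
        congr 1
        rw [← rpow_natCast, ← rpow_natCast s, ← rpow_mul hs0.le, ← rpow_add hs0, ← rpow_sub hs0]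
        norm_num
  set C₂ := B / M * ∫ s in (0 : ℝ)..1, srcP w s with hC₂
  have hwle : ∀ s ∈ Ioc (0 : ℝ) 1, w s ≤ C₂ := fun s hs => by
    rw [hw, div_le_iff₀ hs.1]
    refine (hfle s hs).trans ?_
    refine (mul_le_mul_of_nonneg_left (integral_add_mul_integral_le hP0 hPint' hs)
      (div_pos hB hM).le).trans_eq ?_
    rw [hC₂]; ring
  have hC₂0 : 0 ≤ C₂ := (hw0 1 ⟨one_pos, le_rfl⟩).trans (hwle 1 ⟨one_pos, le_rfl⟩)
  have hFle : ∀ s ∈ Ioc (0 : ℝ) 1, srcF w s ≤ C₂ ^ 5 * s ^ (0 : ℝ) := fun s hs => by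
    have h1 := hw0 s hs
    have h2 := hwle s hs
    have hs0 := hs.1
    calc srcF w s = s * w s ^ 5 := rfl
      _ ≤ 1 * C₂ ^ 5 := by gcongr; exact hs.2
      _ = _ := by simp
  have hFint := intervalIntegrable_of_le_rpow (by norm_num) hFc hF0 hFle
  have hFint' : IntervalIntegrable (fun s => s * srcF w s) MeasureTheory.volume 0 1 :=
    hFint.continuousOn_mul continuousOn_id
  set C₃ := B' * ∫ s in (0 : ℝ)..1, srcF w s with hC₃
  have hple : ∀ s ∈ Ioc (0 : ℝ) 1, pot w s ≤ C₃ * s := fun s hs => by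
    refine (hsol' _ hFc hF0 hFint' s hs).trans ?_
    refine (mul_le_mul_of_nonneg_left (integral_add_mul_integral_le hF0 hFint hs)
      hB'.le).trans_eq ?_
    rw [hC₃]; ring
  have hPle : ∀ s ∈ Ioc (0 : ℝ) 1, srcP w s ≤ C₂ ^ 4 * C₃ * s := fun s hs => by
    have h1 := hw0 s hs
    have h2 := hwle s hs
    calc srcP w s = w s ^ 4 * pot w s := rfl
      _ ≤ C₂ ^ 4 * (C₃ * s) := by
        gcongr
        exacts [hpot0 s (Ioc_subset_Icc_self hs), hple s hs]
      _ = _ := by ring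
  have hPzero : srcP w 0 = 0 := by simp [srcP]
  have hPcc : ContinuousOn (srcP w) (Icc 0 1) := by
    intro s hs
    rcases hs.1.eq_or_lt with rfl | h0
    · have hc : Continuous fun s : ℝ => C₂ ^ 4 * C₃ * s := by fun_prop
      have ht : Tendsto (fun s : ℝ => C₂ ^ 4 * C₃ * s) (𝓝[Icc 0 1] 0) (𝓝 0) := by
        simpa using (hc.tendsto 0).mono_left nhdsWithin_le_nhds
      unfold ContinuousWithinAt
      rw [hPzero]
      have key : ∀ s ∈ Icc (0 : ℝ) 1, 0 ≤ srcP w s ∧ srcP w s ≤ C₂ ^ 4 * C₃ * s := fun s hs => by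
        rcases hs.1.eq_or_lt with rfl | h0
        · simp [hPzero]
        · exact ⟨hP0 s ⟨h0, hs.2⟩, hPle s ⟨h0, hs.2⟩⟩
      exact squeeze_zero' (eventually_nhdsWithin_of_forall fun s hs => (key s hs).1)
        (eventually_nhdsWithin_of_forall fun s hs => (key s hs).2) ht
    · have h1 := hPc s ⟨h0, hs.2⟩
      refine h1.mono_of_mem_nhdsWithin ?_
      have : Ioi 0 ∩ Icc (0 : ℝ) 1 ∈ 𝓝[Icc 0 1] s :=
        Filter.inter_mem (mem_nhdsWithin_of_mem_nhds (Ioi_mem_nhds h0)) self_mem_nhdsWithin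
      exact Filter.mem_of_superset this fun x hx => ⟨hx.1, hx.2.2⟩
  set p : ℝ → ℝ := IccExtend zero_le_one ((Icc (0 : ℝ) 1).domRestrict (srcP w)) with hp
  have hpcont : Continuous p := hPcc.domRestrict.Icc_extend'
  have hpeq : ∀ s ∈ Icc (0 : ℝ) 1, p s = srcP w s := fun s hs => by
    rw [hp, IccExtend_of_mem _ _ hs]; rfl
  have hg : ∀ r ∈ Icc (0 : ℝ) 1, G.sol p r = M * f r := fun r hr => by
    rw [G.sol_congr hpeq r hr, heq r hr]
  set u : ℝ → ℝ := fun r => dslope (G.sol p) 0 r / M with hu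
  have huc : Continuous u := (continuous_dslope_zero (G.hasDerivAt_sol hpcont)).div_const M
  have hru : ∀ r ∈ Icc (0 : ℝ) 1, r * u r = f r := fun r hr => by
    rw [hu]
    simp only
    rw [← mul_div_assoc, G.mul_dslope_sol, hg r hr]
    field_simp
  have huw : ∀ r ∈ Ioc (0 : ℝ) 1, u r = w r := fun r hr => by
    rw [hw]
    simp only
    rw [← hru r (Ioc_subset_Icc_self hr), mul_div_cancel_left₀ _ hr.1.ne']
  have hsF : ∀ s ∈ Icc (0 : ℝ) 1, srcF u s = srcF w s := fun s hs => by
    rcases hs.1.eq_or_lt with rfl | h0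
    · simp [srcF]
    · simp only [srcF, huw s ⟨h0, hs.2⟩]
  have hpotu : ∀ s ∈ Icc (0 : ℝ) 1, pot u s = pot w s := GreenPair.laplace.sol_congr hsF
  have hsP : ∀ s ∈ Icc (0 : ℝ) 1, srcP u s = srcP w s := fun s hs => by
    rcases hs.1.eq_or_lt with rfl | h0
    · simp [srcP]
    · simp only [srcP, huw s ⟨h0, hs.2⟩, hpotu s hs]
  have hupos : ∀ r ∈ Ico (0 : ℝ) 1, 0 < u r := by
    intro r hr
    refine div_pos (dslope_pos_of_concaveOn (continuous_dslope_zero (G.hasDerivAt_sol hpcont))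
      ?_ (G.sol_zero _) (G.sol_one _) ?_ r hr) hM
    · exact (hconc.smul hM.le).congr fun r hr => (hg r hr).symm
    · obtain ⟨r, hr, h⟩ := hpos
      exact ⟨r, hr, by rw [hg r hr]; positivity⟩
  refine ⟨u, M, hM, huc, fun r hr => ?_, hupos, ?_⟩
  · rw [G.sol_congr hsP r hr, ← heq r hr, hru r hr]
  · refine dslope_pos_of_concaveOn (continuous_dslope_zero (hasDerivAt_pot huc))
      (concaveOn_pot huc fun r hr => ?_) (pot_zero u) (pot_one u)
      ⟨1 / 2, by norm_num, pot_half_pos huc hupos⟩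
    rcases hr.2.eq_or_lt with rfl | h
    · exact (by simpa [f_one] using hru 1 z1 : u 1 = 0).ge
    · exact (hupos r ⟨hr.1, h⟩).le

/-- The Talenti bubble profile of width `e`. -/
def bubble (e r : ℝ) : ℝ := (√(e ^ 2 + r ^ 2))⁻¹

section
variable {e : ℝ}

lemma bubble_pos (he : 0 < e) (r : ℝ) : 0 < bubble e r := by
  unfold bubble; positivity

lemma bubble_sq_mul (he : 0 < e) (r : ℝ) : bubble e r ^ 2 * (e ^ 2 + r ^ 2) = 1 := by
  have h : 0 < e ^ 2 + r ^ 2 := by positivity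
  rw [bubble, inv_pow, sq_sqrt h.le, inv_mul_cancel₀ h.ne']

lemma hasDerivAt_bubble (he : 0 < e) (r : ℝ) :
    HasDerivAt (bubble e) (-(r * bubble e r ^ 3)) r := by
  have h : 0 < e ^ 2 + r ^ 2 := by positivity
  have h1 : HasDerivAt (fun r : ℝ => e ^ 2 + r ^ 2) (2 * r) r := by
    simpa using ((hasDerivAt_pow 2 r).const_add (e ^ 2))
  have h2 := (h1.sqrt h.ne').inv (sqrt_pos.2 h).ne'
  refine HasDerivAt.congr_deriv h2 ?_
  have h3 := sqrt_pos.2 h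
  unfold bubble
  field_simp

lemma continuous_bubble (he : 0 < e) : Continuous (bubble e) :=
  continuous_iff_continuousAt.2 fun r => (hasDerivAt_bubble he r).continuousAt

lemma bubble_anti (he : 0 < e) {r : ℝ} (hr : r ∈ Icc (0 : ℝ) 1) : bubble e 1 ≤ bubble e r := by
  unfold bubble
  have := hr.1
  have h2 := hr.2
  gcongr

lemma mul_bubble_sq_le (he : 0 < e) (r : ℝ) : r ^ 2 * bubble e r ^ 2 ≤ 1 := by
  have := bubble_sq_mul he r
  nlinarith [mul_nonneg (sq_nonneg e) (sq_nonneg (bubble e r))]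

lemma bubble_one_le (he : 0 < e) : bubble e 1 ≤ 1 := by
  have := mul_bubble_sq_le he 1
  have := bubble_pos he 1
  nlinarith

/-- A primitive of `r ^ 2 * bubble e r ^ 6`. -/
def bubblePrim (e r : ℝ) : ℝ :=
  arctan (r / e) / (8 * e ^ 3) + r * (r ^ 2 - e ^ 2) * bubble e r ^ 4 / (8 * e ^ 2)

lemma hasDerivAt_arctan_div (he : 0 < e) (r : ℝ) :
    HasDerivAt (fun r => arctan (r / e)) (e * bubble e r ^ 2) r := by
  have h := ((hasDerivAt_id r).div_const e).arctan
  refine HasDerivAt.congr_deriv h ?_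
  have h3 : 0 < e ^ 2 + r ^ 2 := by positivity
  rw [bubble, inv_pow, sq_sqrt h3.le]
  simp only [id]
  field_simp

lemma hasDerivAt_bubblePrim (he : 0 < e) (r : ℝ) :
    HasDerivAt (bubblePrim e) (r ^ 2 * bubble e r ^ 6) r := by
  have hB := hasDerivAt_bubble he r
  have h1 : HasDerivAt (fun r : ℝ => r * (r ^ 2 - e ^ 2)) (1 * (r ^ 2 - e ^ 2) + r * (2 * r)) r := by
    refine ((hasDerivAt_id r).mul ((hasDerivAt_pow 2 r).sub_const (e ^ 2))).congr_deriv ?_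
    simp
  have h2 := ((hasDerivAt_arctan_div he r).div_const (8 * e ^ 3)).add
    ((h1.mul (hB.pow 4)).div_const (8 * e ^ 2))
  refine HasDerivAt.congr_deriv h2 ?_
  have h3 := bubble_sq_mul he r
  set b := bubble e r
  have h4 : b ^ 2 = b ^ 6 * (e ^ 2 + r ^ 2) ^ 2 := by
    calc b ^ 2 = b ^ 2 * (b ^ 2 * (e ^ 2 + r ^ 2)) ^ 2 := by rw [h3]; ring
      _ = _ := by ring
  have h5 : b ^ 4 = b ^ 6 * (e ^ 2 + r ^ 2) := by
    calc b ^ 4 = b ^ 4 * (b ^ 2 * (e ^ 2 + r ^ 2)) := by rw [h3]; ring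
      _ = _ := by ring
  rw [h4, show (bubble e ^ 4) r = b ^ 6 * (e ^ 2 + r ^ 2) from h5]
  push_cast
  field_simp
  ring

lemma arctan_one_div_bounds (he : 0 < e) :
    π / 2 - e ≤ arctan (1 / e) ∧ arctan (1 / e) ≤ π / 2 - e / (1 + e ^ 2) := by
  have h0 : 0 < arctan e := arctan_pos.2 he
  have h1 : arctan (1 / e) = π / 2 - arctan e := by
    rw [one_div]; exact arctan_inv_of_pos he
  have h2 : arctan e ≤ e := by
    have := lt_tan h0 (arctan_lt_pi_div_two e)
    rw [tan_arctan] at this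
    exact this.le
  have h3 : e / (1 + e ^ 2) ≤ arctan e := by
    have h4 := sin_le h0.le
    rw [sin_arctan] at h4
    refine le_trans ?_ h4
    gcongr
    rw [sqrt_le_left (by positivity)]
    nlinarith [sq_nonneg e]
  rw [h1]
  constructor <;> linarith

lemma bubblePrim_zero : bubblePrim e 0 = 0 := by simp [bubblePrim]

lemma bubblePrim_one_le (he : 0 < e) : bubblePrim e 1 ≤ π / (16 * e ^ 3) := by
  have h := (arctan_one_div_bounds he).2
  have h3 := bubble_sq_mul he 1
  have h4 : bubble e 1 ^ 4 = 1 / (1 + e ^ 2) ^ 2 := by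
    have : bubble e 1 ^ 2 = 1 / (1 + e ^ 2) := by
      rw [eq_div_iff (by positivity)]; linarith
    rw [show bubble e 1 ^ 4 = (bubble e 1 ^ 2) ^ 2 by ring, this, div_pow, one_pow]
  rw [bubblePrim, h4]
  calc arctan (1 / e) / (8 * e ^ 3) + 1 * (1 ^ 2 - e ^ 2) * (1 / (1 + e ^ 2) ^ 2) / (8 * e ^ 2)
      ≤ (π / 2 - e / (1 + e ^ 2)) / (8 * e ^ 3)
        + 1 * (1 ^ 2 - e ^ 2) * (1 / (1 + e ^ 2) ^ 2) / (8 * e ^ 2) := by gcongr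
    _ = π / (16 * e ^ 3) - 2 * e ^ 2 / (8 * e ^ 2 * (1 + e ^ 2) ^ 2) := by
      field_simp; ring
    _ ≤ _ := by
      have : 0 ≤ 2 * e ^ 2 / (8 * e ^ 2 * (1 + e ^ 2) ^ 2) := by positivity
      linarith

lemma le_bubblePrim_one (he : 0 < e) : π / (16 * e ^ 3) - 3 / 8 ≤ bubblePrim e 1 := by
  have h := (arctan_one_div_bounds he).1
  have h3 := bubble_sq_mul he 1
  have h4 : 1 - 3 * e ^ 2 ≤ (1 - e ^ 2) * bubble e 1 ^ 4 := by
    have : bubble e 1 ^ 2 = 1 / (1 + e ^ 2) := by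
      rw [eq_div_iff (by positivity)]; linarith
    rw [show bubble e 1 ^ 4 = (bubble e 1 ^ 2) ^ 2 by ring, this, div_pow, mul_div_assoc',
      le_div_iff₀ (by positivity)]
    nlinarith [sq_nonneg e, sq_nonneg (e ^ 2), sq_nonneg (e ^ 3)]
  calc π / (16 * e ^ 3) - 3 / 8 = (π / 2 - e) / (8 * e ^ 3) + (1 - 3 * e ^ 2) / (8 * e ^ 2) := by
        field_simp; ring
    _ ≤ arctan (1 / e) / (8 * e ^ 3) + (1 - e ^ 2) * bubble e 1 ^ 4 / (8 * e ^ 2) := by gcongr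
    _ = _ := by rw [bubblePrim]; ring

lemma integral_le_sub_of_le {g h H : ℝ → ℝ} (hg : Continuous g) (hh : Continuous h)
    (hH : ∀ r, HasDerivAt H (h r) r) (hle : ∀ r ∈ Icc (0 : ℝ) 1, g r ≤ h r) :
    ∫ r in (0 : ℝ)..1, g r ≤ H 1 - H 0 := by
  rw [← intervalIntegral.integral_eq_sub_of_hasDerivAt (fun r _ => hH r)
    (hh.intervalIntegrable _ _)]
  exact intervalIntegral.integral_mono_on zero_le_one (hg.intervalIntegrable _ _)
    (hh.intervalIntegrable _ _) hle

lemma sub_le_integral_of_le {g h H : ℝ → ℝ} (hg : Continuous g) (hh : Continuous h)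
    (hH : ∀ r, HasDerivAt H (h r) r) (hle : ∀ r ∈ Icc (0 : ℝ) 1, h r ≤ g r) :
    H 1 - H 0 ≤ ∫ r in (0 : ℝ)..1, g r := by
  rw [← intervalIntegral.integral_eq_sub_of_hasDerivAt (fun r _ => hH r)
    (hh.intervalIntegrable _ _)]
  exact intervalIntegral.integral_mono_on zero_le_one (hh.intervalIntegrable _ _)
    (hg.intervalIntegrable _ _) hle

end

/-- The bubble truncated by `1 - r ^ 2`. -/
def cutBubble (e r : ℝ) : ℝ := (1 - r ^ 2) * bubble e r

/-- The derivative of `r * cutBubble e r`. -/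
def cutBubble' (e r : ℝ) : ℝ := (1 - r ^ 2) * (e ^ 2 * bubble e r ^ 3) - 2 * r ^ 2 * bubble e r

section
variable {e : ℝ} (he : 0 < e)
include he

lemma hasDerivAt_mul_bubble (r : ℝ) :
    HasDerivAt (fun r => r * bubble e r) (e ^ 2 * bubble e r ^ 3) r := by
  refine ((hasDerivAt_id r).mul (hasDerivAt_bubble he r)).congr_deriv ?_
  have h3 := bubble_sq_mul he r
  simp only [id]
  linear_combination (-bubble e r) * h3

lemma hasDerivAt_bubble_pow (n : ℕ) (r : ℝ) :
    HasDerivAt (fun r => bubble e r ^ n) (n * bubble e r ^ (n - 1) * -(r * bubble e r ^ 3)) r :=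
  (hasDerivAt_bubble he r).pow n

lemma adm_cutBubble : Adm (cutBubble e) (cutBubble' e) where
  cont := by
    have := continuous_bubble he
    unfold cutBubble; fun_prop
  cont' := by
    have := continuous_bubble he
    unfold cutBubble'; fun_prop
  deriv r := by
    have h1 : HasDerivAt (fun r : ℝ => 1 - r ^ 2) (-(2 * r)) r := by
      simpa using (hasDerivAt_pow 2 r).const_sub 1
    have h2 := h1.mul (hasDerivAt_mul_bubble he r)
    refine HasDerivAt.congr_deriv (h2.congr_of_eventuallyEq (Eventually.of_forall fun x => ?_)) ?_
    · simp only [cutBubble, Pi.mul_apply]; ring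
    · unfold cutBubble'; ring
  one := by simp [cutBubble]
  nonneg r hr := by
    have := bubble_pos he r
    have : 0 ≤ 1 - r ^ 2 := by nlinarith [hr.1, hr.2]
    unfold cutBubble; positivity

lemma integral_cutBubble'_sq_le :
    ∫ r in (0 : ℝ)..1, cutBubble' e r ^ 2 ≤ 3 * π / (16 * e) + 4 / 3 := by
  have hc := continuous_bubble he
  have hc' := (adm_cutBubble he).cont'
  have hH : ∀ r, HasDerivAt (fun r => (1 - r ^ 2) ^ 2 * r * e ^ 2 * bubble e r ^ 4
      + 3 * e ^ 2 * bubblePrim e r + 4 / 3 * r ^ 3)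
      (e ^ 2 * (-4 * r ^ 2 * (1 - r ^ 2) * bubble e r ^ 4
        + (1 - r ^ 2) ^ 2 * (bubble e r ^ 4 - 4 * r ^ 2 * bubble e r ^ 6))
        + 3 * e ^ 2 * (r ^ 2 * bubble e r ^ 6) + 4 * r ^ 2) r := by
    intro r
    have h1 : HasDerivAt (fun r : ℝ => (1 - r ^ 2) ^ 2 * r * e ^ 2)
        ((-4 * r * (1 - r ^ 2) * r + (1 - r ^ 2) ^ 2) * e ^ 2) r := by
      have h1 : HasDerivAt (fun r : ℝ => 1 - r ^ 2) (-(2 * r)) r := by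
        simpa using (hasDerivAt_pow 2 r).const_sub 1
      refine (((h1.pow 2).mul (hasDerivAt_id r)).mul_const (e ^ 2)).congr_deriv ?_
      simp only [id, Pi.pow_apply]; push_cast; ring
    refine (((h1.mul (hasDerivAt_bubble_pow he 4 r)).add
      ((hasDerivAt_bubblePrim he r).const_mul (3 * e ^ 2))).add
      ((hasDerivAt_pow 3 r).const_mul (4 / 3))).congr_deriv ?_
    push_cast
    ring
  have h := integral_le_sub_of_le (g := fun r => cutBubble' e r ^ 2) (by fun_prop) (by fun_prop)
    hH fun r hr => ?_
  · have hA := bubblePrim_one_le he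
    have : 3 * e ^ 2 * bubblePrim e 1 ≤ 3 * e ^ 2 * (π / (16 * e ^ 3)) := by gcongr
    have h2 : 3 * e ^ 2 * (π / (16 * e ^ 3)) = 3 * π / (16 * e) := by field_simp
    simp only [bubblePrim_zero] at h
    norm_num at h
    linarith
  · have h3 := bubble_sq_mul he r
    have h4 := mul_bubble_sq_le he r
    have h6 : bubble e r ^ 4 = bubble e r ^ 6 * (e ^ 2 + r ^ 2) := by
      linear_combination -bubble e r ^ 4 * h3
    have h5 : 0 ≤ 3 * e ^ 2 * r ^ 2 * bubble e r ^ 6 * (1 - (1 - r ^ 2) ^ 2) := by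
      have : 0 ≤ 1 - (1 - r ^ 2) ^ 2 := by
        have : r ^ 2 ≤ 1 := by nlinarith [hr.1, hr.2]
        nlinarith [sq_nonneg r]
      positivity
    have h7 : 0 ≤ 4 * r ^ 2 * (1 - r ^ 2 * bubble e r ^ 2) := by
      have : 0 ≤ 1 - r ^ 2 * bubble e r ^ 2 := by linarith
      positivity
    unfold cutBubble'
    have h8 : (1 - r ^ 2) ^ 2 * e ^ 2 * (bubble e r ^ 4 - bubble e r ^ 6 * (e ^ 2 + r ^ 2)) = 0 := by
      rw [← h6]; ring
    nlinarith

lemma le_integral_cutBubble_sq :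
    8 / 15 - π / 2 * e ≤ ∫ r in (0 : ℝ)..1, (r * cutBubble e r) ^ 2 := by
  have hc := continuous_bubble he
  have hc' := (adm_cutBubble he).cont
  have hH : ∀ r, HasDerivAt (fun r => r - 2 / 3 * r ^ 3 + 1 / 5 * r ^ 5 - e * arctan (r / e))
      ((1 - r ^ 2) ^ 2 - e ^ 2 * bubble e r ^ 2) r := by
    intro r
    refine ((((hasDerivAt_id r).sub ((hasDerivAt_pow 3 r).const_mul (2 / 3))).add
      ((hasDerivAt_pow 5 r).const_mul (1 / 5))).sub
      ((hasDerivAt_arctan_div he r).const_mul e)).congr_deriv ?_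
    push_cast
    ring
  have h := sub_le_integral_of_le (g := fun r => (r * cutBubble e r) ^ 2) (by fun_prop)
    (by fun_prop) hH fun r hr => ?_
  · have : e * arctan (1 / e) ≤ e * (π / 2) := by
      gcongr; exact (arctan_lt_pi_div_two _).le
    norm_num at h this
    linarith
  · have h3 := bubble_sq_mul he r
    have h4 : (1 - r ^ 2) ^ 2 ≤ 1 := by
      have : r ^ 2 ≤ 1 := by nlinarith [hr.1, hr.2]
      nlinarith [sq_nonneg r]
    have h5 : (r * cutBubble e r) ^ 2 = (1 - r ^ 2) ^ 2 * (1 - e ^ 2 * bubble e r ^ 2) := by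
      unfold cutBubble
      linear_combination (1 - r ^ 2) ^ 2 * h3
    rw [h5]
    nlinarith [mul_nonneg (sq_nonneg e) (sq_nonneg (bubble e r))]

lemma le_dbl_cutBubble :
    1 / (3 * e ^ 2) * (π / (16 * e ^ 3) - 3 / 8 - 1 / (3 * e ^ 2) - 5 * π / e)
      ≤ dbl (cutBubble e) := by
  have hc := continuous_bubble he
  have hu := (adm_cutBubble he).cont
  set β := bubble e 1 with hβ
  have hβ0 : 0 < β := bubble_pos he 1
  have hβ1 : β ≤ 1 := bubble_one_le he
  set η : ℝ → ℝ := fun r => (r * bubble e r - r * β) / (3 * e ^ 2) with hη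
  set η' : ℝ → ℝ := fun r => (e ^ 2 * bubble e r ^ 3 - β) / (3 * e ^ 2) with hη'
  have hηc : Continuous η := by fun_prop
  have hηc' : Continuous η' := by fun_prop
  have d1 : ∀ r, HasDerivAt η (η' r) r := fun r => by
    refine (((hasDerivAt_mul_bubble he r).sub
      ((hasDerivAt_id r).mul_const β)).div_const (3 * e ^ 2)).congr_deriv ?_
    simp [hη']
  have d2 : ∀ r, HasDerivAt η' (-(r * bubble e r ^ 5)) r := fun r => by
    refine ((((hasDerivAt_bubble_pow he 3 r).const_mul (e ^ 2)).sub_const β).div_const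
      (3 * e ^ 2)).congr_deriv ?_
    push_cast
    field_simp
  have z0 : η 0 = 0 := by simp [hη]
  have z1 : η 1 = 0 := by simp [hη, hβ]
  have h1 := le_dbl hu d1 hηc' z0 z1
  have h2 := integral_deriv_mul_deriv d2 d1 (by fun_prop) hηc' z0 z1
  have h_int : ∀ g : ℝ → ℝ, Continuous g → IntervalIntegrable g MeasureTheory.volume 0 1 :=
    fun g hg => hg.intervalIntegrable _ _
  have hF := continuous_srcF hu
  have h3 : ∫ r in (0 : ℝ)..1, (2 * (η r * srcF (cutBubble e) r) + -(r * bubble e r ^ 5) * η r)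
      ≤ dbl (cutBubble e) := by
    rw [intervalIntegral.integral_add (h_int _ (by fun_prop)) (h_int _ (by fun_prop)),
      intervalIntegral.integral_const_mul]
    simp_rw [sq] at h1
    linarith
  refine le_trans ?_ h3
  have hH : ∀ r, HasDerivAt (fun r => 1 / (3 * e ^ 2) * (bubblePrim e r
      - (r * bubble e r) ^ 3 / (3 * e ^ 2) - 10 / e * arctan (r / e)))
      (1 / (3 * e ^ 2) * (r ^ 2 * bubble e r ^ 6 - r ^ 2 * bubble e r ^ 5
        - 10 * bubble e r ^ 2)) r := by
    intro r
    refine ((((hasDerivAt_bubblePrim he r).sub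
      (((hasDerivAt_mul_bubble he r).pow 3).div_const (3 * e ^ 2))).sub
      ((hasDerivAt_arctan_div he r).const_mul (10 / e))).const_mul (1 / (3 * e ^ 2))).congr_deriv ?_
    push_cast
    field_simp
  have h := sub_le_integral_of_le (by fun_prop)
    (by fun_prop) hH (g := fun r =>
      2 * (η r * srcF (cutBubble e) r) + -(r * bubble e r ^ 5) * η r) fun r hr => ?_
  · refine le_trans ?_ h
    have a1 := le_bubblePrim_one he
    have a2 : 10 / e * arctan (1 / e) ≤ 5 * π / e := by
      have : arctan (1 / e) ≤ π / 2 := (arctan_lt_pi_div_two _).le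
      calc 10 / e * arctan (1 / e) ≤ 10 / e * (π / 2) := by gcongr
        _ = _ := by ring
    have a3 : β ^ 3 / (3 * e ^ 2) ≤ 1 / (3 * e ^ 2) := by
      gcongr; exact pow_le_one₀ hβ0.le hβ1
    rw [bubblePrim_zero, one_mul, ← hβ]
    simp only [zero_mul, zero_div, arctan_zero, mul_zero, sub_zero, ne_eq, OfNat.ofNat_ne_zero,
      not_false_eq_true, zero_pow]
    refine mul_le_mul_of_nonneg_left ?_ (by positivity)
    linarith
  · have hb := bubble_pos he r
    have hbβ : β ≤ bubble e r := bubble_anti he hr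
    have hr1 : r ^ 2 ≤ 1 := by nlinarith [hr.1, hr.2]
    have h4 : 1 - 5 * r ^ 2 ≤ (1 - r ^ 2) ^ 5 := by
      have := one_add_mul_le_pow (a := -r ^ 2) (by linarith) 5
      push_cast at this
      calc 1 - 5 * r ^ 2 = 1 + 5 * -r ^ 2 := by ring
        _ ≤ _ := this
        _ = _ := by ring
    have e1 : 2 * (η r * srcF (cutBubble e) r) + -(r * bubble e r ^ 5) * η r
        = 1 / (3 * e ^ 2) * (r ^ 2 * bubble e r ^ 5 * (bubble e r - β)
          * (2 * (1 - r ^ 2) ^ 5 - 1)) := by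
      simp only [hη, srcF, cutBubble]; ring
    rw [e1]
    refine mul_le_mul_of_nonneg_left ?_ (by positivity)
    have h5 : r ^ 2 * bubble e r ^ 5 * (bubble e r - β) * (1 - 10 * r ^ 2)
        ≤ r ^ 2 * bubble e r ^ 5 * (bubble e r - β) * (2 * (1 - r ^ 2) ^ 5 - 1) := by
      have : 0 ≤ bubble e r - β := by linarith
      refine mul_le_mul_of_nonneg_left (by linarith) (by positivity)
    refine le_trans ?_ h5
    have h6 : (r ^ 2 * bubble e r ^ 2) ^ 2 ≤ 1 :=
      pow_le_one₀ (by positivity) (mul_bubble_sq_le he r)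
    have h7 : bubble e r ^ 2 * (r ^ 2 * bubble e r ^ 2) ^ 2 ≤ bubble e r ^ 2 * 1 := by gcongr
    have h8 : β * (r ^ 2 * bubble e r ^ 5) ≤ 1 * (r ^ 2 * bubble e r ^ 5) := by gcongr
    have h9 : 0 ≤ 10 * β * r ^ 4 * bubble e r ^ 5 := by positivity
    nlinarith

end

lemma GreenPair.sol_const_mul {lam : ℝ} (G : GreenPair lam) (c : ℝ) (p : ℝ → ℝ) (r : ℝ) :
    G.sol (fun s => c * p s) r = c * G.sol p r := by
  have h : ∀ g : ℝ → ℝ, ∀ a b : ℝ, ∫ s in a..b, g s * (c * p s) = c * ∫ s in a..b, g s * p s := by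
    intro g a b
    rw [← intervalIntegral.integral_const_mul]
    exact intervalIntegral.integral_congr fun s _ => by ring
  simp only [GreenPair.sol, h]
  ring

lemma dbl_const_mul (t : ℝ) (u : ℝ → ℝ) : dbl (fun r => t * u r) = t ^ 10 * dbl u := by
  have h1 : srcF (fun r => t * u r) = fun r => t ^ 5 * srcF u r := by
    funext r; simp only [srcF]; ring
  simp only [dbl, pot, h1, GreenPair.sol_const_mul]
  rw [← intervalIntegral.integral_const_mul]
  exact intervalIntegral.integral_congr fun s _ => by ring

lemma quad_const_mul (lam t : ℝ) (u f' : ℝ → ℝ) :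
    quad lam (fun r => t * u r) (fun r => t * f' r) = t ^ 2 * quad lam u f' := by
  have h1 : ∀ r, (t * f' r) ^ 2 = t ^ 2 * f' r ^ 2 := fun r => by ring
  have h2 : ∀ r, (r * (t * u r)) ^ 2 = t ^ 2 * (r * u r) ^ 2 := fun r => by ring
  simp only [quad, h1, h2, intervalIntegral.integral_const_mul]
  ring

lemma Adm.const_mul {u f' : ℝ → ℝ} (h : Adm u f') {t : ℝ} (ht : 0 ≤ t) :
    Adm (fun r => t * u r) (fun r => t * f' r) where
  cont := h.cont.const_mul t
  cont' := h.cont'.const_mul t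
  deriv r := by
    refine HasDerivAt.congr_of_eventuallyEq ((h.deriv r).const_mul t)
      (Eventually.of_forall fun x => ?_)
    ring
  one := by simp [h.one]
  nonneg r hr := mul_nonneg ht (h.nonneg r hr)

lemma mul_quad_pow_lt_dbl_cutBubble {lam : ℝ} (h1 : 3 / 10 * π ^ 2 < lam) (h2 : lam < π ^ 2)
    (hq : 0 ≤ quad lam (cutBubble (1 / 10000)) (cutBubble' (1 / 10000))) :
    (256 / (27 * π ^ 2)) ^ 2 * quad lam (cutBubble (1 / 10000)) (cutBubble' (1 / 10000)) ^ 5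
      < dbl (cutBubble (1 / 10000)) := by
  have he : (0 : ℝ) < 1 / 10000 := by norm_num
  have i1 := integral_cutBubble'_sq_le he
  have i2 := le_integral_cutBubble_sq he
  have i3 := le_dbl_cutBubble he
  rw [show 3 * π / (16 * (1 / 10000)) = 1875 * π by ring] at i1
  rw [show (1 : ℝ) / (3 * (1 / 10000) ^ 2) = 10 ^ 8 / 3 by norm_num,
    show π / (16 * (1 / 10000) ^ 3) = 10 ^ 12 / 16 * π by ring,
    show 5 * π / (1 / 10000) = 50000 * π by ring] at i3
  have p1 := pi_gt_d2
  have p2 := pi_lt_d2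
  have hπ := pi_pos
  have hQ : quad lam (cutBubble (1 / 10000)) (cutBubble' (1 / 10000)) ≤ 1875 * π - 24 / 100 := by
    unfold quad
    generalize (∫ r in (0 : ℝ)..1, cutBubble' (1 / 10000) r ^ 2) = I at i1 ⊢
    generalize (∫ r in (0 : ℝ)..1, (r * cutBubble (1 / 10000) r) ^ 2) = J at i2 ⊢
    have : lam * (8 / 15 - π / 2 * (1 / 10000)) ≤ lam * J :=
      mul_le_mul_of_nonneg_left i2 (by nlinarith)
    have q1 : 295 / 100 < lam := by nlinarith
    have q2 : lam * π < 10 * π := mul_lt_mul_of_pos_right (by nlinarith) hπ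
    have q3 : 29578 / 10000 < lam := by nlinarith
    linarith
  refine lt_of_lt_of_le ?_ i3
  have h5 := pow_le_pow_left₀ hq hQ 5
  refine lt_of_le_of_lt (mul_le_mul_of_nonneg_left h5 (by positivity)) ?_
  have h6 : (1875 * π - 24 / 100) ^ 5 ≤ (1875 * π) ^ 5 - 5 * (24 / 100) * (1875 * π) ^ 4
      + 10 * (24 / 100) ^ 2 * (1875 * π) ^ 3 := by
    have : 0 ≤ (1875 * π) ^ 2 * 10 - 5 * (24 / 100) * (1875 * π) + (24 / 100) ^ 2 := by nlinarith
    linarith [mul_nonneg (by norm_num : (0 : ℝ) ≤ (24 / 100) ^ 3) this]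
  refine lt_of_le_of_lt (mul_le_mul_of_nonneg_left h6 (by positivity)) ?_
  rw [div_pow, div_mul_eq_mul_div, div_lt_iff₀ (by positivity)]
  have h7 : 0 < π ^ 3 ∧ 0 < π ^ 4 ∧ 0 < π ^ 5 := ⟨by positivity, by positivity, by positivity⟩
  have h8 : 0 < π ^ 3 * (1619 * π - 13 * π ^ 2 - 3) := mul_pos (by positivity) (by nlinarith)
  linarith [h7.1, h7.2.1, h7.2.2]

theorem exists_large_dbl {s : ℝ} (hs : 0 < s) (hsπ : s < π) (hlow : 3 / 10 * π ^ 2 < s ^ 2) :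
    ∃ u f' : ℝ → ℝ, Adm u f' ∧ quad (s ^ 2) u f' = 1 ∧ (256 / (27 * π ^ 2)) ^ 2 < dbl u := by
  set e : ℝ := 1 / 10000 with he
  have he0 : 0 < e := by norm_num [he]
  have hA := adm_cutBubble he0
  obtain ⟨c, hc, hco⟩ := exists_coercive hs hsπ
  have h0 : 0 < ∫ r in (0 : ℝ)..1, (r * cutBubble e r) ^ 2 := by
    refine lt_of_lt_of_le ?_ (le_integral_cutBubble_sq he0)
    have := pi_lt_four
    rw [he]; linarith
  have h2 := hco _ _ hA.deriv hA.cont' (by simp) (by simp [hA.one])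
  have h1 : 0 < ∫ r in (0 : ℝ)..1, cutBubble' e r ^ 2 := by
    have := mul_pos (sq_pos_of_pos hs) h0
    by_contra! h
    have h3 : ∫ r in (0 : ℝ)..1, cutBubble' e r ^ 2 = 0 :=
      le_antisymm h (intervalIntegral.integral_nonneg zero_le_one fun r _ => sq_nonneg _)
    rw [h3] at h2
    linarith
  set Q := quad (s ^ 2) (cutBubble e) (cutBubble' e) with hQ
  have hQ0 : 0 < Q := (mul_pos hc h1).trans_le h2
  have hlt := mul_quad_pow_lt_dbl_cutBubble hlow (by gcongr) hQ0.le
  have ht : (√Q)⁻¹ ^ 2 = Q⁻¹ := by rw [inv_pow, sq_sqrt hQ0.le]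
  refine ⟨_, _, hA.const_mul (t := (√Q)⁻¹) (by positivity), ?_, ?_⟩
  · rw [quad_const_mul, ht, inv_mul_cancel₀ hQ0.ne']
  · rw [dbl_const_mul, show (√Q)⁻¹ ^ 10 = ((√Q)⁻¹ ^ 2) ^ 5 by ring, ht, inv_pow,
      ← div_eq_inv_mul, lt_div_iff₀ (by positivity)]
    exact hlt

lemma hasFDerivAt_comp_norm_of_ne {f : ℝ → ℝ} {b : ℝ} {x : E3} (hx : x ≠ 0)
    (hf : HasDerivAt f (‖x‖ * b) ‖x‖) :
    HasFDerivAt (fun y : E3 => f ‖y‖) (b • innerSL ℝ x) x := by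
  have hn : 0 < ‖x‖ := norm_pos_iff.2 hx
  have h1 : HasFDerivAt (fun y : E3 => ‖y‖ ^ 2) (2 • innerSL ℝ x) x :=
    (hasStrictFDerivAt_norm_sq x).hasFDerivAt
  have h2 := h1.sqrt (by positivity)
  simp only [sqrt_sq (norm_nonneg _)] at h2
  refine (hf.comp_hasFDerivAt x h2).congr_fderiv ?_
  ext y
  simp
  field_simp

lemma hasFDerivAt_comp_norm_zero {f : ℝ → ℝ} (hf : HasDerivAt f 0 0) :
    HasFDerivAt (fun y : E3 => f ‖y‖) (0 : E3 →L[ℝ] ℝ) 0 := by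
  rw [hasFDerivAt_iff_isLittleO_nhds_zero]
  rw [hasDerivAt_iff_isLittleO_nhds_zero] at hf
  have ht : Tendsto (fun y : E3 => ‖y‖) (𝓝 0) (𝓝 0) := by
    simpa using (continuous_norm (E := E3)).tendsto 0
  have := (hf.comp_tendsto ht).norm_right
  simp only [Function.comp_def, norm_norm] at this
  simpa using this.of_norm_right

/-- The radial slope `U' / r` of `U = F / r`, where `F'' = -r h`. -/
def radialSlope (F F' h : ℝ → ℝ) (r : ℝ) : ℝ :=
  if r = 0 then -h 0 / 3 else (r * F' r - F r) / r ^ 3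

section Radial

variable {F F' h : ℝ → ℝ} (hF : ∀ r, HasDerivAt F (F' r) r)
  (hF' : ∀ r, HasDerivAt F' (-(r * h r)) r) (hh : Continuous h) (hF0 : F 0 = 0)

include hF hF' in
lemma hasDerivAt_radialSlope_num (r : ℝ) :
    HasDerivAt (fun r => r * F' r - F r) (-(r ^ 2 * h r)) r := by
  refine (((hasDerivAt_id r).mul (hF' r)).sub (hF r)).congr_deriv ?_
  simp only [id]
  ring

include hF hF' in
lemma hasDerivAt_radialSlope {r : ℝ} (hr : r ≠ 0) :
    HasDerivAt (radialSlope F F' h) (-(h r + 3 * radialSlope F F' h r) / r) r := by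
  have h1 := (hasDerivAt_radialSlope_num hF hF' r).div (hasDerivAt_pow 3 r) (pow_ne_zero 3 hr)
  have he : radialSlope F F' h =ᶠ[𝓝 r] fun r => (r * F' r - F r) / r ^ 3 := by
    filter_upwards [isOpen_ne.mem_nhds hr] with y hy
    rw [radialSlope, if_neg hy]
  refine (h1.congr_of_eventuallyEq he).congr_deriv ?_
  rw [he.eq_of_nhds]
  push_cast
  field_simp
  ring

include hF hF' hh hF0 in
lemma continuous_radialSlope : Continuous (radialSlope F F' h) := by
  refine continuous_iff_continuousAt.2 fun r => ?_
  rcases eq_or_ne r 0 with rfl | hr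
  · have hN := hasDerivAt_radialSlope_num hF hF'
    have hne : ∀ᶠ x : ℝ in 𝓝[≠] 0, x ≠ 0 := eventually_mem_nhdsWithin
    have h1 : Tendsto (fun r => (r * F' r - F r) / r ^ 3) (𝓝[≠] 0) (𝓝 (-h 0 / 3)) := by
      refine HasDerivAt.lhopital_zero_nhdsNE (Eventually.of_forall hN)
        (Eventually.of_forall fun r => hasDerivAt_pow 3 r) ?_ ?_ ?_ ?_
      · filter_upwards [hne] with x hx
        simpa using hx
      · have := (hN 0).continuousAt.tendsto
        simp only [zero_mul, hF0, sub_zero] at this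
        exact this.mono_left nhdsWithin_le_nhds
      · have := (continuous_pow 3 : Continuous fun x : ℝ => x ^ 3).tendsto 0
        simp only [ne_eq, OfNat.ofNat_ne_zero, not_false_eq_true, zero_pow] at this
        exact this.mono_left nhdsWithin_le_nhds
      · have h2 : Tendsto (fun x => -h x / 3) (𝓝[≠] 0) (𝓝 (-h 0 / 3)) :=
          (hh.neg.div_const 3).continuousAt.tendsto.mono_left nhdsWithin_le_nhds
        refine h2.congr' ?_
        filter_upwards [hne] with x hx
        push_cast
        field_simp
    rw [continuousAt_iff_punctured_nhds]
    have h3 : radialSlope F F' h 0 = -h 0 / 3 := if_pos rfl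
    rw [h3]
    refine h1.congr' ?_
    filter_upwards [hne] with x hx
    rw [radialSlope, if_neg hx]
  · exact (hasDerivAt_radialSlope hF hF' hr).continuousAt

include hF hF' hh hF0 in
lemma hasDerivAt_dslope_zero (r : ℝ) :
    HasDerivAt (dslope F 0) (r * radialSlope F F' h r) r := by
  have hA := continuous_radialSlope hF hF' hh hF0
  refine hasDerivAt_of_hasDerivAt_of_ne' (g := fun r => r * radialSlope F F' h r) (x := 0)
    (fun y hy => ?_) (continuous_dslope_zero hF).continuousAt (by fun_prop) r
  have he : dslope F 0 =ᶠ[𝓝 y] fun r => F r / r := by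
    filter_upwards [isOpen_ne.mem_nhds hy] with z hz
    rw [dslope_of_ne _ hz, slope_def_field, hF0, sub_zero, sub_zero]
  refine (((hF y).div (hasDerivAt_id y) hy).congr_of_eventuallyEq he).congr_deriv ?_
  rw [radialSlope, if_neg hy]
  simp only [id]
  field_simp

/-- The gradient of the radial function `x ↦ dslope F 0 ‖x‖`. -/
def radialGrad (F F' h : ℝ → ℝ) (x : E3) : E3 := radialSlope F F' h ‖x‖ • x

/-- The derivative of `radialGrad F F' h`. -/
def radialHess (F F' h : ℝ → ℝ) (x : E3) : E3 →L[ℝ] E3 :=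
  radialSlope F F' h ‖x‖ • ContinuousLinearMap.id ℝ E3
    + (-(h ‖x‖ + 3 * radialSlope F F' h ‖x‖) / ‖x‖ ^ 2) • (innerSL ℝ x).smulRight x

include hF hF' hh hF0 in
lemma hasFDerivAt_radial (x : E3) :
    HasFDerivAt (fun y : E3 => dslope F 0 ‖y‖) (innerSL ℝ (radialGrad F F' h x)) x := by
  have hd := hasDerivAt_dslope_zero hF hF' hh hF0
  rcases eq_or_ne x 0 with rfl | hx
  · have h0 := hd 0
    rw [zero_mul] at h0
    simpa [radialGrad] using hasFDerivAt_comp_norm_zero h0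
  · refine (hasFDerivAt_comp_norm_of_ne hx (hd ‖x‖)).congr_fderiv ?_
    simp [radialGrad]

include hF hF' hh hF0 in
lemma hasFDerivAt_radialGrad (x : E3) :
    HasFDerivAt (radialGrad F F' h) (radialHess F F' h x) x := by
  have hA := continuous_radialSlope hF hF' hh hF0
  rcases eq_or_ne x 0 with rfl | hx
  · have hz : radialHess F F' h 0 = radialSlope F F' h 0 • ContinuousLinearMap.id ℝ E3 := by
      simp [radialHess]
    rw [hz, hasFDerivAt_iff_isLittleO_nhds_zero]
    have h1 : Tendsto (fun y : E3 => radialSlope F F' h ‖y‖ - radialSlope F F' h 0)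
        (𝓝 0) (𝓝 0) := by
      have : Continuous fun y : E3 => radialSlope F F' h ‖y‖ - radialSlope F F' h 0 := by fun_prop
      simpa using this.tendsto 0
    have h2 := ((Asymptotics.isLittleO_one_iff ℝ).2 h1).smul_isBigO
      (Asymptotics.isBigO_refl (fun y : E3 => y) (𝓝 0))
    simp only [one_smul] at h2
    refine h2.congr_left fun y => ?_
    simp [radialGrad, sub_smul]
  · have hn : 0 < ‖x‖ := norm_pos_iff.2 hx
    have h1 := hasFDerivAt_comp_norm_of_ne hx (f := radialSlope F F' h)
      (b := -(h ‖x‖ + 3 * radialSlope F F' h ‖x‖) / ‖x‖ ^ 2)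
      ((hasDerivAt_radialSlope hF hF' hn.ne').congr_deriv (by field_simp))
    refine (h1.smul (hasFDerivAt_id x)).congr_fderiv ?_
    ext y
    simp [radialHess, smul_smul]

include hF hF' hh hF0 in
lemma continuous_radialHess : Continuous (radialHess F F' h) := by
  have hA := continuous_radialSlope hF hF' hh hF0
  unfold radialHess
  refine Continuous.add (by fun_prop) (continuous_iff_continuousAt.2 fun x => ?_)
  have hL : Continuous fun y : E3 => (innerSL ℝ y).smulRight y := by fun_prop
  rcases eq_or_ne x 0 with rfl | hx
  · rw [ContinuousAt]
    simp only [norm_zero, map_zero, ContinuousLinearMap.smulRight_zero, smul_zero]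
    have h1 : Tendsto (fun y : E3 => |h ‖y‖ + 3 * radialSlope F F' h ‖y‖|) (𝓝 0) (𝓝 0) := by
      have : Continuous fun y : E3 => |h ‖y‖ + 3 * radialSlope F F' h ‖y‖| := by fun_prop
      have h2 := this.tendsto 0
      have h3 : radialSlope F F' h 0 = -h 0 / 3 := if_pos rfl
      have h4 : h 0 + 3 * (-h 0 / 3) = 0 := by ring
      simpa [h3, h4] using h2
    refine squeeze_zero_norm (fun y => ?_) h1
    rw [norm_smul, ContinuousLinearMap.norm_smulRight_apply, innerSL_apply_norm, norm_div,
      norm_neg, norm_pow, norm_norm, Real.norm_eq_abs]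
    rcases eq_or_ne y 0 with rfl | hy
    · simp
    · have := norm_pos_iff.2 hy
      exact le_of_eq (by field_simp)
  · have hn : ‖x‖ ^ 2 ≠ 0 := pow_ne_zero 2 (norm_ne_zero_iff.2 hx)
    have h1 : ContinuousAt (fun y : E3 => -(h ‖y‖ + 3 * radialSlope F F' h ‖y‖) / ‖y‖ ^ 2) x :=
      ContinuousAt.div (Continuous.continuousAt (by fun_prop))
        (Continuous.continuousAt (by fun_prop)) hn
    exact h1.smul hL.continuousAt

include hF hF' hh hF0 in
lemma contDiff_radial : ContDiff ℝ 2 fun y : E3 => dslope F 0 ‖y‖ := by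
  have h1 : ContDiff ℝ 1 (radialGrad F F' h) := contDiff_one_iff_hasFDerivAt.2
    ⟨_, continuous_radialHess hF hF' hh hF0, hasFDerivAt_radialGrad hF hF' hh hF0⟩
  have h2 : ContDiff ℝ (1 : ℕ) fun x => innerSL ℝ (radialGrad F F' h x) :=
    (innerSL ℝ).contDiff.comp h1
  exact contDiff_succ_iff_hasFDerivAt.2 ⟨_, h2, hasFDerivAt_radial hF hF' hh hF0⟩

include hF hF' hh hF0 in
lemma lap_radial (x : E3) : lap (fun y : E3 => dslope F 0 ‖y‖) x = -h ‖x‖ := by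
  have h1 : ∀ i : Fin 3, fderiv ℝ (fun y => fderiv ℝ (fun y : E3 => dslope F 0 ‖y‖) y
      (EuclideanSpace.single i 1)) x (EuclideanSpace.single i 1)
      = radialSlope F F' h ‖x‖
        + (-(h ‖x‖ + 3 * radialSlope F F' h ‖x‖) / ‖x‖ ^ 2) * x i ^ 2 := by
    intro i
    have h2 : ∀ y, fderiv ℝ (fun y : E3 => dslope F 0 ‖y‖) y (EuclideanSpace.single i 1)
        = innerSL ℝ (EuclideanSpace.single i (1 : ℝ)) (radialGrad F F' h y) := fun y => by
      rw [(hasFDerivAt_radial hF hF' hh hF0 y).fderiv, innerSL_apply_apply, innerSL_apply_apply,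
        real_inner_comm]
    simp only [h2]
    have h3 : HasFDerivAt
        (fun y => innerSL ℝ (EuclideanSpace.single i (1 : ℝ)) (radialGrad F F' h y))
        ((innerSL ℝ (EuclideanSpace.single i (1 : ℝ))).comp (radialHess F F' h x)) x :=
      (innerSL ℝ (EuclideanSpace.single i (1 : ℝ))).hasFDerivAt.comp x
        (hasFDerivAt_radialGrad hF hF' hh hF0 x)
    rw [h3.fderiv]
    simp [radialHess, EuclideanSpace.inner_single_left, EuclideanSpace.inner_single_right]
    left
    ring
  rw [lap]
  simp only [h1, Finset.sum_add_distrib, ← Finset.mul_sum]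
  rw [← EuclideanSpace.real_norm_sq_eq]
  rcases eq_or_ne x 0 with rfl | hx
  · have h3 : radialSlope F F' h 0 = -h 0 / 3 := if_pos rfl
    simp [h3]
    ring
  · have hn : 0 < ‖x‖ := norm_pos_iff.2 hx
    simp
    field_simp
    ring

end Radial

lemma dslope_zero_scale {f : ℝ → ℝ} {f' c R : ℝ} (hf : HasDerivAt f f' 0) (h0 : f 0 = 0)
    (hR : R ≠ 0) (r : ℝ) :
    dslope (fun r => c * R * f (r / R)) 0 r = c * dslope f 0 (r / R) := by
  rcases eq_or_ne r 0 with rfl | hr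
  · have h1 : HasDerivAt (fun r => c * R * f (r / R)) (c * R * (f' * (1 / R))) 0 := by
      have h2 : HasDerivAt f f' (0 / R) := by rwa [zero_div]
      exact (h2.comp 0 ((hasDerivAt_id 0).div_const R)).const_mul (c * R)
    rw [zero_div, dslope_same, dslope_same, h1.deriv, hf.deriv]
    field_simp
  · rw [dslope_of_ne _ hr, dslope_of_ne _ (div_ne_zero hr hR), slope_def_field, slope_def_field]
    simp only [zero_div, h0, mul_zero, sub_zero]
    field_simp

lemma hasDerivAt_comp_div {f : ℝ → ℝ} {f' : ℝ} (c R : ℝ) {r : ℝ} (hf : HasDerivAt f f' (r / R)) :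
    HasDerivAt (fun r => c * f (r / R)) (c * (f' * (1 / R))) r :=
  (hf.comp r ((hasDerivAt_id r).div_const R)).const_mul c

end

/-- If `λ ∈ (3/10·λ₁, λ₁)` with `λ₁ = π²/R²` the first Dirichlet eigenvalue of `-Δ` on `B_R`,
then problem (P) admits a classical solution `(u, φ)` with `u > 0` and `φ > 0` in `B_R`. -/
theorem existence_positive_solution (R q lam : ℝ) (hR : 0 < R) (hq : 0 < q)
    (hlow : 3 / 10 * (π ^ 2 / R ^ 2) < lam) (hhigh : lam < π ^ 2 / R ^ 2) :
    ∃ u φ : E3 → ℝ, IsSolP R q lam u φ ∧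
      (∀ x ∈ ball (0:E3) R, 0 < u x) ∧ (∀ x ∈ ball (0:E3) R, 0 < φ x) := by
  have hlam : 0 < lam := lt_trans (by positivity) hlow
  have hs2 : (R * √lam) ^ 2 = R ^ 2 * lam := by rw [mul_pow, sq_sqrt hlam.le]
  set s := R * √lam with hs
  have hs0 : 0 < s := by positivity
  have hsπ : s < π := by
    rw [lt_div_iff₀ (by positivity)] at hhigh
    exact lt_of_pow_lt_pow_left₀ 2 pi_pos.le (by linarith)
  have hslow : 3 / 10 * π ^ 2 < s ^ 2 := by
    rw [mul_div_assoc', div_lt_iff₀ (by positivity)] at hlow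
    linarith
  obtain ⟨u₀, f₀', h₀, hQ₀, hD₀⟩ := exists_large_dbl hs0 hsπ hslow
  obtain ⟨c, hc, hco⟩ := exists_coercive hs0 hsπ
  set G := GreenPair.helmholtz s hs0 hsπ
  obtain ⟨u, M, hM, hu, heq, hupos, hDpos⟩ :=
    exists_regular_profile G (sq_nonneg s) hc hco h₀ hQ₀ hD₀
  obtain ⟨a, ha, ha8⟩ : ∃ a : ℝ, 0 < a ∧ a ^ 8 = 1 / (M * q ^ 2 * R ^ 4) :=
    ⟨(1 / (M * q ^ 2 * R ^ 4)) ^ ((8 : ℕ) : ℝ)⁻¹, by positivity,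
      rpow_inv_natCast_pow (by positivity) (by norm_num)⟩
  have hP : Continuous (srcP u) := continuous_srcP hu
  have hS := G.hasDerivAt_sol hP
  have hS' := G.hasDerivAt_sol' hP
  have hV := hasDerivAt_pot hu
  have hV' := hasDerivAt_pot' hu
  set S := dslope (G.sol (srcP u)) 0 with hSdef
  set V := dslope (pot u) 0 with hVdef
  have hSc : Continuous S := continuous_dslope_zero hS
  have hVc : Continuous V := continuous_dslope_zero hV
  have hSm : ∀ r, r * S r = G.sol (srcP u) r := G.mul_dslope_sol _
  have hVm : ∀ r, r * V r = pot u r := GreenPair.laplace.mul_dslope_sol _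
  have hSu : ∀ r ∈ Icc (0 : ℝ) 1, S r = M * u r := by
    have h1 : Ioo (0 : ℝ) 1 ⊆ {r | S r = M * u r} := fun r hr => by
      have := heq r (Ioo_subset_Icc_self hr)
      rw [← hSm] at this
      exact mul_left_cancel₀ hr.1.ne' (by linarith)
    have := closure_minimal h1 (isClosed_eq hSc (by fun_prop))
    rwa [closure_Ioo (by norm_num)] at this
  set b := q * R ^ 2 * a ^ 5 with hb
  have hb0 : 0 < b := by positivity
  set F₁ : ℝ → ℝ := fun r => a / M * R * G.sol (srcP u) (r / R) with hF₁
  set F₂ : ℝ → ℝ := fun r => b * R * pot u (r / R) with hF₂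
  set h₁ : ℝ → ℝ := fun r => a / (M * R ^ 2) * (s ^ 2 * S (r / R) + u (r / R) ^ 4 * V (r / R))
    with hh₁
  set h₂ : ℝ → ℝ := fun r => b / R ^ 2 * u (r / R) ^ 5 with hh₂
  have d1 : ∀ r, HasDerivAt F₁ (a / M * G.sol' (srcP u) (r / R)) r := fun r =>
    (hasDerivAt_comp_div (a / M * R) R (hS (r / R))).congr_deriv (by field_simp)
  have d1' : ∀ r, HasDerivAt (fun r => a / M * G.sol' (srcP u) (r / R)) (-(r * h₁ r)) r := fun r =>
    (hasDerivAt_comp_div (a / M) R (hS' (r / R))).congr_deriv (by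
      rw [← hSm, hh₁, srcP, ← hVm]; field_simp; ring)
  have d2 : ∀ r, HasDerivAt F₂ (b * pot' u (r / R)) r := fun r =>
    (hasDerivAt_comp_div (b * R) R (hV (r / R))).congr_deriv (by field_simp)
  have d2' : ∀ r, HasDerivAt (fun r => b * pot' u (r / R)) (-(r * h₂ r)) r := fun r =>
    (hasDerivAt_comp_div b R (hV' (r / R))).congr_deriv (by
      rw [hh₂, srcF]; field_simp)
  have c1 : Continuous h₁ := by fun_prop
  have c2 : Continuous h₂ := by fun_prop
  have z1 : F₁ 0 = 0 := by simp [hF₁]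
  have z2 : F₂ 0 = 0 := by simp [hF₂, pot_zero]
  have e1 : ∀ r, dslope F₁ 0 r = a / M * S (r / R) :=
    dslope_zero_scale (hS 0) (by simp) hR.ne'
  have e2 : ∀ r, dslope F₂ 0 r = b * V (r / R) :=
    dslope_zero_scale (hV 0) (by simp [pot_zero]) hR.ne'
  have hball : ∀ x ∈ ball (0 : E3) R, ‖x‖ / R ∈ Ico (0 : ℝ) 1 := fun x hx => by
    rw [mem_ball_zero_iff] at hx
    exact ⟨by positivity, (div_lt_one hR).2 hx⟩
  have e3 : ∀ x ∈ ball (0 : E3) R, dslope F₁ 0 ‖x‖ = a * u (‖x‖ / R) := fun x hx => by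
    rw [e1, hSu _ (Ico_subset_Icc_self (hball x hx))]
    field_simp
  have p1 : ∀ x ∈ ball (0 : E3) R, 0 < dslope F₁ 0 ‖x‖ := fun x hx => by
    rw [e3 x hx]; exact mul_pos ha (hupos _ (hball x hx))
  have p2 : ∀ x ∈ ball (0 : E3) R, 0 < dslope F₂ 0 ‖x‖ := fun x hx => by
    rw [e2]; exact mul_pos hb0 (hDpos _ (hball x hx))
  have C1 := contDiff_radial d1 d1' c1 z1
  have C2 := contDiff_radial d2 d2' c2 z2
  refine ⟨fun x => dslope F₁ 0 ‖x‖, fun x => dslope F₂ 0 ‖x‖, ⟨C1.contDiffOn, C2.contDiffOn,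
    C1.continuous.continuousOn, C2.continuous.continuousOn, fun x hx => ?_, fun x hx => ?_,
    fun x hx => ?_, fun x hx => ?_⟩, p1, p2⟩
  · rw [lap_radial d1 d1' c1 z1, neg_neg]
    beta_reduce
    rw [abs_of_pos (p1 x hx), e3 x hx, e2]
    simp only [hh₁]
    rw [hSu _ (Ico_subset_Icc_self (hball x hx)), hs2]
    have h8 : a / (M * R ^ 2) = q * a ^ 4 * b := by
      calc a / (M * R ^ 2) = a * (q ^ 2 * R ^ 2) * (1 / (M * q ^ 2 * R ^ 4)) := by field_simp
        _ = _ := by rw [← ha8, hb]; ring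
    calc a / (M * R ^ 2) * (R ^ 2 * lam * (M * u (‖x‖ / R)) + u (‖x‖ / R) ^ 4 * V (‖x‖ / R))
        = lam * (a * u (‖x‖ / R)) + a / (M * R ^ 2) * (u (‖x‖ / R) ^ 4 * V (‖x‖ / R)) := by
          field_simp
      _ = _ := by rw [h8]; ring
  · rw [lap_radial d2 d2' c2 z2, neg_neg]
    beta_reduce
    rw [abs_of_pos (p1 x hx), e3 x hx]
    simp only [hh₂, hb]
    field_simp
  · rw [mem_sphere_zero_iff_norm] at hx
    have : (1 : ℝ) * S 1 = 0 := by rw [hSm, G.sol_one]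
    simp only [hx, e1, div_self hR.ne']
    rw [← one_mul (S 1), this, mul_zero]
  · rw [mem_sphere_zero_iff_norm] at hx
    have : (1 : ℝ) * V 1 = 0 := by rw [hVm, pot_one]
    simp only [hx, e2, div_self hR.ne']
    rw [← one_mul (V 1), this, mul_zero]
end
end

section
/- Let q ∈ ℝ, let φ : ℝ³ → ℝ be C² and u : ℝ³ → ℝ be continuous on an open set U ⊆ ℝ³, and define the vector field W(y) = (y·∇φ(y))∇φ(y) − (|∇φ(y)|²/2)·y. Then at every point x ∈ U where Δφ(x) + q|u(x)|⁵ = 0, the divergence of W satisfies div W(x) = −(1/2)|∇φ(x)|² − q(x·∇φ(x))|u(x)|⁵. -/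
open Metric Real Set
open scoped RealInnerProductSpace

noncomputable section

/-- The divergence of a vector field `W : ℝ³ → ℝ³`, i.e. the trace of its derivative. -/
def divg (W : E3 → E3) (x : E3) : ℝ :=
  ∑ i : Fin 3, fderiv ℝ W x (EuclideanSpace.single i 1) i

/-- The second derivative of a function in terms of the derivative of its gradient. -/
theorem hasFDerivAt_fderiv_apply_of_hasFDerivAt_gradient {φ : E3 → ℝ} {x : E3} {A : E3 →L[ℝ] E3}
    (hA : HasFDerivAt (gradient φ) A x) (v : E3) :
    HasFDerivAt (fun y => fderiv ℝ φ y v) ((innerSL ℝ v).comp A) x := by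
  have h := ((innerSL ℝ v).hasFDerivAt (x := gradient φ x)).comp x hA
  refine h.congr_of_eventuallyEq (Filter.Eventually.of_forall fun y => ?_)
  simp only [Function.comp, innerSL_apply_apply, gradient]
  rw [real_inner_comm, InnerProductSpace.toDual_symm_apply]

/-- The gradient of a `C²` function is differentiable. -/
theorem ContDiffAt.differentiableAt_gradient {φ : E3 → ℝ} {x : E3} (h : ContDiffAt ℝ 2 φ x) :
    DifferentiableAt ℝ (gradient φ) x := by
  have h1 : DifferentiableAt ℝ (fderiv ℝ φ) x :=
    (h.fderiv_right (m := 1) (by norm_num)).differentiableAt (by norm_num)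
  exact ((InnerProductSpace.toDual ℝ E3).symm.toContinuousLinearEquiv.differentiableAt
    (x := fderiv ℝ φ x)).comp x h1

/-- The derivative of the gradient of a `C²` function is symmetric. -/
theorem ContDiffAt.inner_fderiv_gradient_comm {φ : E3 → ℝ} {x : E3} (h : ContDiffAt ℝ 2 φ x)
    (v w : E3) :
    ⟪v, fderiv ℝ (gradient φ) x w⟫ = ⟪w, fderiv ℝ (gradient φ) x v⟫ := by
  have h1 : DifferentiableAt ℝ (fderiv ℝ φ) x :=
    (h.fderiv_right (m := 1) (by norm_num)).differentiableAt (by norm_num)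
  have hs : IsSymmSndFDerivAt ℝ φ x := h.isSymmSndFDerivAt (by simp)
  have key (v w : E3) : ⟪v, fderiv ℝ (gradient φ) x w⟫ = fderiv ℝ (fderiv ℝ φ) x w v := by
    have e1 := hasFDerivAt_fderiv_apply_of_hasFDerivAt_gradient
      h.differentiableAt_gradient.hasFDerivAt v
    have e2 := h1.hasFDerivAt.clm_apply (hasFDerivAt_const v x)
    simpa using DFunLike.congr_fun (e1.unique e2) w
  rw [key, key, hs.eq]

/-- The Laplacian is the divergence of the gradient. -/
theorem lap_eq_divg_gradient {φ : E3 → ℝ} {x : E3}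
    (h : DifferentiableAt ℝ (gradient φ) x) : lap φ x = divg (gradient φ) x := by
  unfold lap divg
  refine Finset.sum_congr rfl fun i _ => ?_
  rw [(hasFDerivAt_fderiv_apply_of_hasFDerivAt_gradient h.hasFDerivAt _).fderiv]
  simp [EuclideanSpace.inner_single_left]

/-- Divergence of the vector field `(y·G)G - (|G|²/2)y` when the derivative of `G` is symmetric. -/
theorem divg_inner_smul_sub_norm_sq_smul {G : E3 → E3} {x : E3} (hG : DifferentiableAt ℝ G x)
    (hsymm : ∀ v w, ⟪v, fderiv ℝ G x w⟫ = ⟪w, fderiv ℝ G x v⟫) :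
    divg (fun y => ⟪y, G y⟫ • G y - (‖G y‖ ^ 2 / 2) • y) x
      = ⟪x, G x⟫ * divg G x - (1 / 2) * ‖G x‖ ^ 2 := by
  have hA := hG.hasFDerivAt
  have hid := hasFDerivAt_id (𝕜 := ℝ) x
  have hW := ((hid.inner ℝ hA).smul hA).sub ((hA.norm_sq.mul_const (1 / 2 : ℝ)).smul hid)
  have hW' := hW.congr_of_eventuallyEq
    (f₁ := fun y => ⟪y, G y⟫ • G y - (‖G y‖ ^ 2 / 2) • y)
    (Filter.Eventually.of_forall fun y => by simp [div_eq_mul_inv])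
  have h1 (i : Fin 3) : fderiv ℝ (fun y => ⟪y, G y⟫ • G y - (‖G y‖ ^ 2 / 2) • y) x
      (EuclideanSpace.single i 1) i
      = ⟪x, G x⟫ * fderiv ℝ G x (EuclideanSpace.single i 1) i
        + fderiv ℝ G x x i * G x i + G x i * G x i
        - fderiv ℝ G x (G x) i * x i - ‖G x‖ ^ 2 / 2 := by
    have a1 := hsymm x (EuclideanSpace.single i 1)
    have a2 := hsymm (G x) (EuclideanSpace.single i 1)
    rw [EuclideanSpace.inner_single_left] at a1 a2
    rw [hW'.fderiv]
    simp [EuclideanSpace.inner_single_left, fderivInnerCLM_apply, a1, a2]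
    ring
  have h2 : ∑ i, fderiv ℝ G x x i * G x i = ∑ i, fderiv ℝ G x (G x) i * x i := by
    have := hsymm (G x) x
    simpa [PiLp.inner_apply] using this
  have h3 : ∑ i, G x i * G x i = ‖G x‖ ^ 2 := by
    simp [EuclideanSpace.norm_sq_eq, ← sq]
  unfold divg
  simp only [h1, Finset.sum_add_distrib, Finset.sum_sub_distrib, h2, h3, ← Finset.mul_sum]
  simp
  ring

/-- Pohozaev-type pointwise divergence identity for the second equation: if
`Δφ + q|u|⁵ = 0` at `x`, then the vector field `W(y) = (y·∇φ)∇φ − (|∇φ|²/2)y` satisfies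
`div W = −½|∇φ|² − q(x·∇φ)|u|⁵` at `x`. -/
theorem pohozaev_divergence_phi (q : ℝ) (U : Set E3) (hU : IsOpen U) (u φ : E3 → ℝ)
    (hφ : ContDiffOn ℝ 2 φ U) (hu : ContinuousOn u U)
    (x : E3) (hx : x ∈ U)
    (heq : lap φ x + q * |u x| ^ 5 = 0) :
    divg (fun y => ⟪y, gradient φ y⟫ • gradient φ y - (‖gradient φ y‖ ^ 2 / 2) • y) x
      = -(1 / 2) * ‖gradient φ x‖ ^ 2 - q * ⟪x, gradient φ x⟫ * |u x| ^ 5 := by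
  have h : ContDiffAt ℝ 2 φ x := hφ.contDiffAt (hU.mem_nhds hx)
  have hG := h.differentiableAt_gradient
  rw [divg_inner_smul_sub_norm_sq_smul hG h.inner_fderiv_gradient_comm,
    ← lap_eq_divg_gradient hG]
  linear_combination ⟪x, gradient φ x⟫ * heq
end
end
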